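/- Let k be a field of characteristic zero and A a standard graded artinian k-algebra of socle degree D, with Hilbert function h_i = dim_k A_i (h_i = 0 for i < 0 and i > D). Then the following are equivalent: (1) A is almost centered and has the strong Lefschetz property; (2) A has the strong Lefschetz property and either h_{i−1} ≤ h_{D−i} ≤ h_i for all 0 ≤ i ≤ ⌊D/2⌋, or h_{D−i+1} ≤ h_i ≤ h_{D−i} for all 0 ≤ i ≤ ⌊D/2⌋; (3) A ⊗_k k[x]/(x^d) has the strong Lefschetz property for all d ≥ 1; (4) A ⊗_k k[x₁,…,xₙ]/(x₁^{d₁},…,xₙ^{dₙ}) has the strong Lefschetz property for all n ≥ 1 and all d₁,…,dₙ ≥ 1; (5) A ⊗_k k[x₁,…,xₙ]/(x₁²,…,xₙ²) has the weak Lefschetz property for all n ≥ 0. -/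

import Mathlib

open scoped BigOperators

/-- Multiplication by `a` is injective as a map on the subspace `V`. -/
def MulInjOn {k R : Type*} [Field k] [CommRing R] [Algebra k R]
    (V : Submodule k R) (a : R) : Prop :=
  ∀ v ∈ V, a * v = 0 → v = 0

/-- Multiplication by `a` maps the subspace `V` onto the subspace `W`. -/
def MulSurjOnto {k R : Type*} [Field k] [CommRing R] [Algebra k R]
    (V W : Submodule k R) (a : R) : Prop :=
  ∀ w ∈ W, ∃ v ∈ V, a * v = w

/-- The multiplication map `·a : V → W` has full rank: it is injective or surjective. -/
def MulFullRank {k R : Type*} [Field k] [CommRing R] [Algebra k R]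
    (V W : Submodule k R) (a : R) : Prop :=
  MulInjOn V a ∨ MulSurjOnto V W a

/-- `𝒜` is the grading of a standard graded artinian `k`-algebra structure on `R`:
the components form an internal direct sum, vanish in negative degrees, are
multiplicative, the degree-zero part is spanned by `1`, the algebra is generated in
degree one, and `R` is a finite-dimensional `k`-vector space (equivalently, artinian). -/
structure IsStdGradedArtinian (k : Type*) [Field k] (R : Type*) [CommRing R] [Algebra k R]
    (𝒜 : ℤ → Submodule k R) : Prop where
  internal : DirectSum.IsInternal 𝒜
  one_mem : (1 : R) ∈ 𝒜 0
  mul_mem : ∀ {i j : ℤ} {a b : R}, a ∈ 𝒜 i → b ∈ 𝒜 j → a * b ∈ 𝒜 (i + j)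
  neg_bot : ∀ i : ℤ, i < 0 → 𝒜 i = ⊥
  zero_spanOne : 𝒜 0 = Submodule.span k {(1 : R)}
  succ_eq : ∀ i : ℤ, 0 ≤ i → 𝒜 (i + 1) = 𝒜 1 * 𝒜 i
  finiteDim : FiniteDimensional k R

/-- `A` (graded by `ℬ`) is the extension `B ⊗ₖ k[x]/(x^d)` of `B` (graded by `𝒜`):
`φ` is the canonical inclusion of `B`, `x` has degree one with `x^d = 0`, and each
graded component decomposes as `ℬ j = ⊕_{q=0}^{d-1} x^q · φ(𝒜 (j - q))`. -/
structure IsCIExtension {k B A : Type*} [Field k] [CommRing B] [Algebra k B]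
    [CommRing A] [Algebra k A]
    (𝒜 : ℤ → Submodule k B) (ℬ : ℤ → Submodule k A)
    (φ : B →ₐ[k] A) (x : A) (d : ℕ) : Prop where
  map_mem : ∀ (j : ℤ) (b : B), b ∈ 𝒜 j → φ b ∈ ℬ j
  x_mem : x ∈ ℬ 1
  x_pow : x ^ d = 0
  decomp_mem : ∀ (j : ℤ) (f : Fin d → B), (∀ q : Fin d, f q ∈ 𝒜 (j - ((q : ℕ) : ℤ))) →
    (∑ q : Fin d, x ^ (q : ℕ) * φ (f q)) ∈ ℬ j
  decomp_exists : ∀ (j : ℤ), ∀ c ∈ ℬ j, ∃ f : Fin d → B,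
    (∀ q : Fin d, f q ∈ 𝒜 (j - ((q : ℕ) : ℤ))) ∧ c = ∑ q : Fin d, x ^ (q : ℕ) * φ (f q)
  decomp_unique : ∀ (j : ℤ) (f : Fin d → B), (∀ q : Fin d, f q ∈ 𝒜 (j - ((q : ℕ) : ℤ))) →
    (∑ q : Fin d, x ^ (q : ℕ) * φ (f q)) = 0 → ∀ q : Fin d, f q = 0

/-- `A` (graded by `ℬ`) is the extension `B ⊗ₖ k[x₁,…,xₙ]/(x₁^{d₁},…,xₙ^{dₙ})` of `B`
(graded by `𝒜`). -/
structure IsMultiCIExtension {k B A : Type*} [Field k] [CommRing B] [Algebra k B]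
    [CommRing A] [Algebra k A] {n : ℕ}
    (𝒜 : ℤ → Submodule k B) (ℬ : ℤ → Submodule k A)
    (φ : B →ₐ[k] A) (x : Fin n → A) (dv : Fin n → ℕ) : Prop where
  map_mem : ∀ (j : ℤ) (b : B), b ∈ 𝒜 j → φ b ∈ ℬ j
  x_mem : ∀ m : Fin n, x m ∈ ℬ 1
  x_pow : ∀ m : Fin n, x m ^ dv m = 0
  decomp_mem : ∀ (j : ℤ) (f : ((m : Fin n) → Fin (dv m)) → B),
    (∀ e, f e ∈ 𝒜 (j - ∑ m : Fin n, ((e m : ℕ) : ℤ))) →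
    (∑ e : (m : Fin n) → Fin (dv m), (∏ m : Fin n, x m ^ ((e m : ℕ))) * φ (f e)) ∈ ℬ j
  decomp_exists : ∀ (j : ℤ), ∀ c ∈ ℬ j, ∃ f : ((m : Fin n) → Fin (dv m)) → B,
    (∀ e, f e ∈ 𝒜 (j - ∑ m : Fin n, ((e m : ℕ) : ℤ))) ∧
    c = ∑ e : (m : Fin n) → Fin (dv m), (∏ m : Fin n, x m ^ ((e m : ℕ))) * φ (f e)
  decomp_unique : ∀ (j : ℤ) (f : ((m : Fin n) → Fin (dv m)) → B),
    (∀ e, f e ∈ 𝒜 (j - ∑ m : Fin n, ((e m : ℕ) : ℤ))) →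
    (∑ e : (m : Fin n) → Fin (dv m), (∏ m : Fin n, x m ^ ((e m : ℕ))) * φ (f e)) = 0 →
    ∀ e, f e = 0

/-- The weak Lefschetz property. -/
def HasWLP {k R : Type*} [Field k] [CommRing R] [Algebra k R]
    (𝒜 : ℤ → Submodule k R) : Prop :=
  ∃ ℓ ∈ 𝒜 1, ∀ i : ℤ, 0 ≤ i → MulFullRank (𝒜 i) (𝒜 (i + 1)) ℓ

/-- The strong Lefschetz property. -/
def HasSLP {k R : Type*} [Field k] [CommRing R] [Algebra k R]
    (𝒜 : ℤ → Submodule k R) : Prop :=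
  ∃ ℓ ∈ 𝒜 1, ∀ i : ℤ, 0 ≤ i → ∀ t : ℕ, 1 ≤ t → MulFullRank (𝒜 i) (𝒜 (i + t)) (ℓ ^ t)

/-- The Hilbert function of the graded algebra. -/
noncomputable def hilb {k R : Type*} [Field k] [CommRing R] [Algebra k R]
    (𝒜 : ℤ → Submodule k R) (i : ℤ) : ℕ :=
  Module.finrank k (𝒜 i)

/-- The algebra is almost centered. -/
def AlmostCentered {k R : Type*} [Field k] [CommRing R] [Algebra k R]
    (𝒜 : ℤ → Submodule k R) : Prop :=
  ∀ i j : ℤ, i < j →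
    (hilb 𝒜 i < hilb 𝒜 j → ∀ s : ℕ, hilb 𝒜 (i - s) ≤ hilb 𝒜 (j + s)) ∧
    (hilb 𝒜 j < hilb 𝒜 i → ∀ s : ℕ, hilb 𝒜 (j + s) ≤ hilb 𝒜 (i - s))

/-- `binomZ t j` is the binomial coefficient `t` choose `j` for an integer `j`,
equal to `0` for `j < 0` or `j > t`. -/
def binomZ (t : ℕ) (j : ℤ) : ℤ := if 0 ≤ j then (t.choose j.toNat : ℤ) else 0

/-- The `(d-p) × (d-p)` integer matrix `C_{t,p,d}` whose `(r,c)` entry (with `1 ≤ r,c ≤ d-p`)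
is `binom(t, d+1-r-c)`. -/
def Cmat (t p d : ℕ) : Matrix (Fin (d - p)) (Fin (d - p)) ℤ :=
  Matrix.of fun r c => binomZ t ((d : ℤ) - 1 - (r : ℕ) - (c : ℕ))

/-- The characteristic of `k` is zero, or a prime not dividing the integer `N`. -/
def CharCond (k : Type*) [Field k] (N : ℤ) : Prop :=
  CharZero k ∨ ∃ p : ℕ, p.Prime ∧ CharP k p ∧ ¬ ((p : ℤ) ∣ N)

section GradedEndomorphism

variable {k M M' : Type*} [Field k] [AddCommGroup M'] [Module k M'] [AddCommGroup M] [Module k M]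

/-- The endomorphism `T` has degree one for the family `𝒱`. -/
def RaisesDegree (𝒱 : ℤ → Submodule k M) (T : M →ₗ[k] M) : Prop :=
  ∀ i, ∀ v ∈ 𝒱 i, T v ∈ 𝒱 (i + 1)

/-- All maps `T ^ t : 𝒱 i → 𝒱 (i + t)` with `2 * i + t = N` are injective. -/
def InjAbout (𝒱 : ℤ → Submodule k M) (T : M →ₗ[k] M) (N : ℤ) : Prop :=
  ∀ (i : ℤ) (t : ℕ), 2 * i + t = N → ∀ v ∈ 𝒱 i, (T ^ t) v = 0 → v = 0

/-- All maps `T ^ t : 𝒱 i → 𝒱 (i + t)` with `2 * i + t = N` are surjective. -/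
def SurjAbout (𝒱 : ℤ → Submodule k M) (T : M →ₗ[k] M) (N : ℤ) : Prop :=
  ∀ (i : ℤ) (t : ℕ), 2 * i + t = N → ∀ w ∈ 𝒱 (i + t), ∃ v ∈ 𝒱 i, (T ^ t) v = w

variable {𝒱 : ℤ → Submodule k M} {T : M →ₗ[k] M} {𝒱' : ℤ → Submodule k M'} {T' : M' →ₗ[k] M'}
  {N : ℤ}

theorem RaisesDegree.pow (h : RaisesDegree 𝒱 T) (i : ℤ) (t : ℕ) {v : M} (hv : v ∈ 𝒱 i) :
    (T ^ t) v ∈ 𝒱 (i + t) := by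
  induction t with
  | zero => simpa using hv
  | succ t ih =>
    rw [pow_succ', Module.End.mul_apply]
    have := h _ _ ih
    rwa [show i + ((t + 1 : ℕ) : ℤ) = i + t + 1 by push_cast; ring]

theorem InjAbout.mono (h : InjAbout 𝒱 T N) {N' : ℤ} (hN : N' ≤ N) : InjAbout 𝒱 T N' := by
  intro i t hit v hv h0
  refine h i ((N - N').toNat + t) (by push_cast; omega) v hv ?_
  rw [pow_add, Module.End.mul_apply, h0, map_zero]

theorem SurjAbout.mono (hT : RaisesDegree 𝒱 T) (h : SurjAbout 𝒱 T N) {N' : ℤ} (hN : N ≤ N') :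
    SurjAbout 𝒱 T N' := by
  intro i t hit w hw
  obtain ⟨r, hr⟩ : ∃ r : ℕ, (r : ℤ) = N' - N := ⟨(N' - N).toNat, by omega⟩
  obtain ⟨v, hv, rfl⟩ := h (i - r) (t + r) (by push_cast; omega) w
    (by convert hw using 2; push_cast; ring)
  refine ⟨(T ^ r) v, ?_, by rw [pow_add, Module.End.mul_apply]⟩
  have := hT.pow _ r hv
  rwa [sub_add_cancel] at this

theorem pow_apply_of_comm {Φ : M →ₗ[k] M'} (hc : ∀ v, Φ (T v) = T' (Φ v)) (t : ℕ) (v : M) :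
    Φ ((T ^ t) v) = (T' ^ t) (Φ v) := by
  induction t with
  | zero => simp
  | succ t ih => rw [pow_succ', pow_succ', Module.End.mul_apply, Module.End.mul_apply, hc, ih]

theorem InjAbout.of_embedding {Φ : M →ₗ[k] M'} (hc : ∀ v, Φ (T v) = T' (Φ v))
    (hΦ : ∀ i, ∀ v ∈ 𝒱 i, Φ v ∈ 𝒱' i) (hinj : ∀ i, ∀ v ∈ 𝒱 i, Φ v = 0 → v = 0)
    (h : InjAbout 𝒱' T' N) : InjAbout 𝒱 T N := by
  intro i t hit v hv h0
  refine hinj i v hv (h i t hit _ (hΦ i v hv) ?_)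
  rw [← pow_apply_of_comm hc, h0, map_zero]

theorem InjAbout.of_equiv {Φ : M →ₗ[k] M'} (hc : ∀ v, Φ (T v) = T' (Φ v))
    (hT : RaisesDegree 𝒱 T) (hinj : ∀ i, ∀ v ∈ 𝒱 i, Φ v = 0 → v = 0)
    (hsurj : ∀ i, ∀ w ∈ 𝒱' i, ∃ v ∈ 𝒱 i, Φ v = w)
    (h : InjAbout 𝒱 T N) : InjAbout 𝒱' T' N := by
  intro i t hit w hw h0
  obtain ⟨v, hv, rfl⟩ := hsurj i w hw
  rw [← pow_apply_of_comm hc] at h0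
  rw [h i t hit v hv (hinj _ _ (hT.pow i t hv) h0), map_zero]

theorem SurjAbout.of_quotient {Φ : M →ₗ[k] M'} (hc : ∀ v, Φ (T v) = T' (Φ v))
    (hΦ : ∀ i, ∀ v ∈ 𝒱 i, Φ v ∈ 𝒱' i)
    (hsurj : ∀ i, ∀ w ∈ 𝒱' i, ∃ v ∈ 𝒱 i, Φ v = w)
    (h : SurjAbout 𝒱 T N) : SurjAbout 𝒱' T' N := by
  intro i t hit w hw
  obtain ⟨u, hu, rfl⟩ := hsurj _ w hw
  obtain ⟨v, hv, rfl⟩ := h i t hit u hu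
  exact ⟨Φ v, hΦ i v hv, (pow_apply_of_comm hc t v).symm⟩

theorem RaisesDegree.of_quotient {Φ : M →ₗ[k] M'} (hc : ∀ v, Φ (T v) = T' (Φ v))
    (hΦ : ∀ i, ∀ v ∈ 𝒱 i, Φ v ∈ 𝒱' i)
    (hsurj : ∀ i, ∀ w ∈ 𝒱' i, ∃ v ∈ 𝒱 i, Φ v = w)
    (h : RaisesDegree 𝒱 T) : RaisesDegree 𝒱' T' := by
  intro i w hw
  obtain ⟨v, hv, rfl⟩ := hsurj _ w hw
  rw [← hc]
  exact hΦ _ _ (h i v hv)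

/-- The operator `T + y` on `M ⊗ k[y]/(y²) = M × M`. -/
def pairOp (T : M →ₗ[k] M) : M × M →ₗ[k] M × M where
  toFun p := (T p.1, T p.2 + p.1)
  map_add' p q := by ext <;> simp [add_add_add_comm]
  map_smul' c p := by ext <;> simp

/-- The grading of `M ⊗ k[y]/(y²) = M × M`. -/
def pairGrading (𝒱 : ℤ → Submodule k M) (j : ℤ) : Submodule k (M × M) :=
  (𝒱 j).prod (𝒱 (j - 1))

theorem pairOp_pow_succ (T : M →ₗ[k] M) (t : ℕ) (p : M × M) :
    (pairOp T ^ (t + 1)) p =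
      ((T ^ (t + 1)) p.1, (T ^ (t + 1)) p.2 + ((t : k) + 1) • (T ^ t) p.1) := by
  induction t with
  | zero => simp [pairOp]
  | succ t ih =>
    rw [pow_succ', Module.End.mul_apply, ih]
    simp only [pairOp, LinearMap.coe_mk, AddHom.coe_mk, map_add, map_smul]
    simp only [← Module.End.mul_apply, ← pow_succ']
    ext
    · rfl
    · simp only [Nat.cast_add, Nat.cast_one, add_smul, one_smul]
      abel

theorem InjAbout.pair [CharZero k] (h : InjAbout 𝒱 T N) :
    InjAbout (pairGrading 𝒱) (pairOp T) (N + 1) := by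
  rintro i (_ | t) hit p ⟨hp1, hp2⟩ h0
  · simpa using h0
  rw [pairOp_pow_succ, Prod.mk_eq_zero] at h0
  have h2 : p.2 = 0 := by
    refine h (i - 1) (t + 2) (by push_cast at *; omega) _ hp2 ?_
    have := congrArg T h0.2
    rw [map_add, map_smul, ← Module.End.mul_apply, ← Module.End.mul_apply, ← pow_succ',
      ← pow_succ', h0.1] at this
    simpa using this
  have h1 : p.1 = 0 := by
    refine h i t (by push_cast at *; omega) _ hp1 ?_
    have := h0.2
    rw [h2, map_zero, zero_add, smul_eq_zero] at this
    exact this.resolve_left (by exact_mod_cast Nat.succ_ne_zero t)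
  exact Prod.ext h1 h2

theorem SurjAbout.pair [CharZero k] (hT : RaisesDegree 𝒱 T) (h : SurjAbout 𝒱 T N) :
    SurjAbout (pairGrading 𝒱) (pairOp T) (N + 1) := by
  rintro i (_ | t) hit p ⟨hp1, hp2⟩
  · exact ⟨p, ⟨by simpa using hp1, by simpa using hp2⟩, by simp⟩
  have ht : (t : k) + 1 ≠ 0 := by exact_mod_cast Nat.succ_ne_zero t
  push_cast at hit
  have e1 : i + ((t + 1 : ℕ) : ℤ) - 1 = i + t := by push_cast; ring
  have e2 : i - 1 + ((t + 2 : ℕ) : ℤ) = i + ((t + 1 : ℕ) : ℤ) := by push_cast; ring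
  have e3 : i - 1 + ((t + 1 : ℕ) : ℤ) = i + t := by push_cast; ring
  have hp2' : p.2 ∈ 𝒱 (i + t) := e1 ▸ hp2
  obtain ⟨b, hb, hb'⟩ := h (i - 1) (t + 2) (by push_cast; omega)
    (T p.2 - ((t : k) + 1) • p.1) (by
      rw [e2]
      refine sub_mem ?_ (Submodule.smul_mem _ _ hp1)
      have := hT _ _ hp2'
      rwa [show i + (t : ℤ) + 1 = i + ((t + 1 : ℕ) : ℤ) by push_cast; ring] at this)
  obtain ⟨a, ha, ha'⟩ := h i t (by omega) (((t : k) + 1)⁻¹ • (p.2 - (T ^ (t + 1)) b)) (by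
    refine Submodule.smul_mem _ _ (sub_mem hp2' ?_)
    have := hT.pow _ (t + 1) hb
    rwa [e3] at this)
  refine ⟨(a, b), ⟨ha, hb⟩, ?_⟩
  rw [pairOp_pow_succ]
  ext
  · simp only
    rw [pow_succ', Module.End.mul_apply, ha', map_smul, map_sub, ← Module.End.mul_apply,
      ← pow_succ', hb', sub_sub_cancel, smul_smul, inv_mul_cancel₀ ht, one_smul]
  · simp only
    rw [ha', smul_smul, mul_inv_cancel₀ ht, one_smul, add_sub_cancel]

/-- The shift `f ↦ (0, f 0, f 1, …)` of sequences. -/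
def shiftSeq (f : ℕ → M) : ℕ → M
  | 0 => 0
  | q + 1 => f q

/-- The operator `T + x` on `M ⊗ k[x]/(x^d)`, whose elements are written as sequences of
coefficients. -/
def truncOp (d : ℕ) (T : M →ₗ[k] M) : (ℕ → M) →ₗ[k] (ℕ → M) where
  toFun f q := if q < d then T (f q) + shiftSeq f q else 0
  map_add' f g := by
    ext q
    rcases q with _ | q
    · simp only [shiftSeq, Pi.add_apply]; split_ifs <;> simp
    · simp only [shiftSeq, Pi.add_apply]; split_ifs <;> simp [add_add_add_comm]
  map_smul' c f := by
    ext q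
    rcases q with _ | q <;> simp [shiftSeq]

/-- The grading of `M ⊗ k[x]/(x^d)`. -/
def truncGrading (d : ℕ) (𝒱 : ℤ → Submodule k M) (j : ℤ) : Submodule k (ℕ → M) where
  carrier := {f | (∀ q : ℕ, f q ∈ 𝒱 (j - q)) ∧ ∀ q, d ≤ q → f q = 0}
  add_mem' := fun ha hb => ⟨fun q => add_mem (ha.1 q) (hb.1 q), fun q hq => by
    simp [ha.2 q hq, hb.2 q hq]⟩
  zero_mem' := ⟨fun _ => zero_mem _, fun _ _ => rfl⟩
  smul_mem' := fun c f hf => ⟨fun q => Submodule.smul_mem _ c (hf.1 q), fun q hq => by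
    simp [hf.2 q hq]⟩

theorem RaisesDegree.trunc (hT : RaisesDegree 𝒱 T) (d : ℕ) :
    RaisesDegree (truncGrading d 𝒱) (truncOp d T) := by
  rintro i f ⟨hf, hf'⟩
  refine ⟨fun q => ?_, fun q hq => by simp [truncOp, Nat.not_lt.mpr hq]⟩
  simp only [truncOp, LinearMap.coe_mk, AddHom.coe_mk]
  split_ifs
  · refine add_mem ?_ ?_
    · have := hT _ _ (hf q)
      rwa [show i - (q : ℤ) + 1 = i + 1 - q by ring] at this
    · rcases q with _ | q
      · exact zero_mem _
      · have := hf q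
        rwa [show i - (q : ℤ) = i + 1 - ((q + 1 : ℕ) : ℤ) by push_cast; ring] at this
  · exact zero_mem _

/-- The embedding of `k[z]/(z^(d+1))` into `k[x]/(x^d) ⊗ k[y]/(y²)` given by `z ↦ x + y`. -/
def truncToPair (k M : Type*) [Field k] [AddCommGroup M] [Module k M] (d : ℕ) :
    (ℕ → M) →ₗ[k] (ℕ → M) × (ℕ → M) where
  toFun f := (fun q => if q < d then f q else 0,
    fun q => if q < d then ((q : k) + 1) • f (q + 1) else 0)
  map_add' f g := by ext q <;> simp only [Pi.add_apply, Prod.mk_add_mk] <;> split_ifs <;> simp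
  map_smul' c f := by
    ext q <;> simp only [Pi.smul_apply, Prod.smul_mk, RingHom.id_apply] <;> split_ifs <;>
      simp [smul_comm c]

/-- A retraction up to scalars of `truncToPair`, compatible with multiplication by `x + y`. -/
def pairToTrunc (k M : Type*) [Field k] [AddCommGroup M] [Module k M] (d : ℕ) :
    (ℕ → M) × (ℕ → M) →ₗ[k] (ℕ → M) where
  toFun p q := if q < d + 1 then ((d : k) - q) • p.1 q + shiftSeq p.2 q else 0
  map_add' f g := by
    ext q
    rcases q with _ | q
    · simp [shiftSeq]
    · simp only [shiftSeq, Pi.add_apply, Prod.fst_add, Prod.snd_add]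
      split_ifs
      · rw [smul_add]; abel
      · simp
  map_smul' c f := by
    ext q
    rcases q with _ | q
    · simp [shiftSeq, smul_comm c]
    · simp only [shiftSeq, Pi.smul_apply, Prod.smul_fst, Prod.smul_snd, RingHom.id_apply]
      split_ifs
      · rw [smul_add, smul_comm c]
      · simp

theorem truncToPair_comm (d : ℕ) (T : M →ₗ[k] M) (f : ℕ → M) :
    truncToPair k M d (truncOp (d + 1) T f) = pairOp (truncOp d T) (truncToPair k M d f) := by
  ext q
  · simp only [truncToPair, pairOp, truncOp, LinearMap.coe_mk, AddHom.coe_mk]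
    rcases q with _ | q <;> simp only [shiftSeq] <;> split_ifs <;> first | omega | simp
  · simp only [truncToPair, pairOp, truncOp, LinearMap.coe_mk, AddHom.coe_mk, Pi.add_apply]
    rcases q with _ | q
    · simp only [shiftSeq]
      split_ifs <;> first | omega | simp
    · simp only [shiftSeq]
      split_ifs <;> first | omega | simp
      simp only [add_smul, one_smul]
      abel

theorem pairToTrunc_comm (d : ℕ) (T : M →ₗ[k] M) (p : (ℕ → M) × (ℕ → M)) :
    pairToTrunc k M d (pairOp (truncOp d T) p) = truncOp (d + 1) T (pairToTrunc k M d p) := by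
  ext q
  simp only [pairToTrunc, pairOp, truncOp, LinearMap.coe_mk, AddHom.coe_mk]
  rcases q with _ | q
  · rcases Nat.eq_zero_or_pos d with rfl | hd
    · simp [shiftSeq]
    · simp [shiftSeq, hd]
  · simp only [shiftSeq, Pi.add_apply, add_lt_add_iff_right]
    by_cases h1 : q < d
    · have h2 : ((d : k) - ((q + 1 : ℕ) : k)) • (if q + 1 < d then T (p.1 (q + 1)) + p.1 q else 0) =
          ((d : k) - ((q + 1 : ℕ) : k)) • (T (p.1 (q + 1)) + p.1 q) := by
        rcases eq_or_ne d (q + 1) with rfl | h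
        · simp
        · rw [if_pos (by omega)]
      simp only [if_pos h1, if_pos (show q < d + 1 by omega), h2]
      simp only [smul_add, map_add, map_smul, Nat.cast_add, Nat.cast_one, sub_smul, add_smul,
        one_smul, map_sub]
      cases q <;> abel
    · simp [h1]

theorem InjAbout.trunc [CharZero k] (h : InjAbout 𝒱 T N) (d : ℕ) :
    InjAbout (truncGrading (d + 1) 𝒱) (truncOp (d + 1) T) (N + d) := by
  induction d with
  | zero =>
    rw [Nat.cast_zero, add_zero]
    refine h.of_embedding (Φ := LinearMap.proj 0) (fun f => ?_) (fun i f hf => ?_)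
      (fun i f hf h0 => ?_)
    · simp [truncOp, shiftSeq]
    · simpa using hf.1 0
    · ext q
      rcases q with _ | q
      · exact h0
      · exact hf.2 _ (by omega)
  | succ d ih =>
    have := ih.pair
    rw [show N + (d : ℤ) + 1 = N + ((d + 1 : ℕ) : ℤ) by push_cast; ring] at this
    refine this.of_embedding (Φ := truncToPair k M (d + 1)) (truncToPair_comm _ _)
      (fun i f hf => ?_) (fun i f hf h0 => ?_)
    · refine ⟨⟨fun q => ?_, fun q hq => ?_⟩, ⟨fun q => ?_, fun q hq => ?_⟩⟩
      · simp only [truncToPair, LinearMap.coe_mk, AddHom.coe_mk]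
        split_ifs
        exacts [hf.1 q, zero_mem _]
      · exact if_neg (Nat.not_lt.mpr hq)
      · simp only [truncToPair, LinearMap.coe_mk, AddHom.coe_mk]
        split_ifs
        · have := hf.1 (q + 1)
          rw [show i - ((q + 1 : ℕ) : ℤ) = i - 1 - q by push_cast; ring] at this
          exact Submodule.smul_mem _ _ this
        · exact zero_mem _
      · exact if_neg (Nat.not_lt.mpr hq)
    · have h1 := congrFun (congrArg Prod.fst h0)
      have h2 := congrFun (congrArg Prod.snd h0)
      ext q
      rcases q with _ | q
      · simpa [truncToPair] using h1 0
      · by_cases hq : q < d + 1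
        · have := h2 q
          simp only [truncToPair, LinearMap.coe_mk, AddHom.coe_mk, if_pos hq, Prod.snd_zero,
            Pi.zero_apply, smul_eq_zero] at this
          exact this.resolve_left (by exact_mod_cast Nat.succ_ne_zero q)
        · exact hf.2 _ (by omega)

theorem SurjAbout.trunc [CharZero k] (hT : RaisesDegree 𝒱 T) (h : SurjAbout 𝒱 T N) (d : ℕ) :
    SurjAbout (truncGrading (d + 1) 𝒱) (truncOp (d + 1) T) (N + d) := by
  induction d with
  | zero =>
    rw [Nat.cast_zero, add_zero]
    refine h.of_quotient (Φ := LinearMap.single k (fun _ : ℕ => M) 0) (fun v => ?_)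
      (fun i v hv => ⟨fun q => ?_, fun q hq => ?_⟩) (fun i f hf => ⟨f 0, by simpa using hf.1 0, ?_⟩)
    · ext q
      rcases q with _ | q <;> simp [truncOp, shiftSeq]
    · rcases q with _ | q
      · simpa using hv
      · simp
    · rcases q with _ | q
      · omega
      · simp
    · ext q
      rcases q with _ | q
      · simp
      · simp [hf.2 (q + 1) (by omega)]
  | succ d ih =>
    have := ih.pair (hT.trunc _)
    rw [show N + (d : ℤ) + 1 = N + ((d + 1 : ℕ) : ℤ) by push_cast; ring] at this
    refine this.of_quotient (Φ := pairToTrunc k M (d + 1)) (pairToTrunc_comm _ _)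
      (fun i p hp => ⟨fun q => ?_, fun q hq => ?_⟩) (fun i f hf => ?_)
    · simp only [pairToTrunc, LinearMap.coe_mk, AddHom.coe_mk]
      split_ifs
      · refine add_mem (Submodule.smul_mem _ _ (hp.1.1 q)) ?_
        rcases q with _ | q
        · exact zero_mem _
        · have := hp.2.1 q
          rwa [show i - 1 - (q : ℤ) = i - ((q + 1 : ℕ) : ℤ) by push_cast; ring] at this
      · exact zero_mem _
    · exact if_neg (Nat.not_lt.mpr hq)
    · have hd : ((d + 1 : ℕ) : k) ≠ 0 := by exact_mod_cast Nat.succ_ne_zero d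
      refine ⟨(Pi.single 0 (((d + 1 : ℕ) : k)⁻¹ • f 0), fun q => f (q + 1)),
        ⟨⟨fun q => ?_, fun q hq => ?_⟩, ⟨fun q => ?_, fun q hq => hf.2 _ (by omega)⟩⟩, ?_⟩
      · rcases q with _ | q
        · simpa using Submodule.smul_mem _ _ (by simpa using hf.1 0)
        · simp
      · rcases q with _ | q
        · omega
        · simp
      · have := hf.1 (q + 1)
        rwa [show i - ((q + 1 : ℕ) : ℤ) = i - 1 - q by push_cast; ring] at this
      · ext q
        simp only [pairToTrunc, LinearMap.coe_mk, AddHom.coe_mk]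
        split_ifs with hq
        · rcases q with _ | q
          · simp only [shiftSeq, Pi.single_eq_same, Nat.cast_zero, sub_zero, add_zero]
            rw [smul_smul, mul_inv_cancel₀ hd, one_smul]
          · simp [shiftSeq]
        · exact (hf.2 q (by omega)).symm

end GradedEndomorphism

section Decompositions

variable {k B A : Type*} [Field k] [CommRing B] [Algebra k B] [CommRing A] [Algebra k A]

/-- The families `𝒜` and `ℬ` satisfy `ℬ j = ⊕_{q<d} x^q · φ(𝒜 (j - q))`, where `x^d = 0`. -/
structure IsTruncSum (𝒜 : ℤ → Submodule k B) (ℬ : ℤ → Submodule k A) (φ : B →ₐ[k] A) (x : A)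
    (d : ℕ) : Prop where
  x_pow : x ^ d = 0
  mem : ∀ (j : ℤ) (f : Fin d → B), (∀ q : Fin d, f q ∈ 𝒜 (j - ((q : ℕ) : ℤ))) →
    (∑ q : Fin d, x ^ (q : ℕ) * φ (f q)) ∈ ℬ j
  exists_eq : ∀ (j : ℤ), ∀ c ∈ ℬ j, ∃ f : Fin d → B,
    (∀ q : Fin d, f q ∈ 𝒜 (j - ((q : ℕ) : ℤ))) ∧ c = ∑ q : Fin d, x ^ (q : ℕ) * φ (f q)
  eq_zero : ∀ (j : ℤ) (f : Fin d → B), (∀ q : Fin d, f q ∈ 𝒜 (j - ((q : ℕ) : ℤ))) →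
    (∑ q : Fin d, x ^ (q : ℕ) * φ (f q)) = 0 → ∀ q : Fin d, f q = 0

/-- The families `𝒜` and `ℬ` satisfy `ℬ j = ⊕_e x^e · φ(𝒜 (j - |e|))`, where `e` runs over the
exponent vectors below `dv`, and `x_m^{d_m} = 0`. -/
structure IsMultiTruncSum {n : ℕ} (𝒜 : ℤ → Submodule k B) (ℬ : ℤ → Submodule k A) (φ : B →ₐ[k] A)
    (x : Fin n → A) (dv : Fin n → ℕ) : Prop where
  x_pow : ∀ m : Fin n, x m ^ dv m = 0
  mem : ∀ (j : ℤ) (f : ((m : Fin n) → Fin (dv m)) → B),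
    (∀ e, f e ∈ 𝒜 (j - ∑ m : Fin n, ((e m : ℕ) : ℤ))) →
    (∑ e : (m : Fin n) → Fin (dv m), (∏ m : Fin n, x m ^ ((e m : ℕ))) * φ (f e)) ∈ ℬ j
  exists_eq : ∀ (j : ℤ), ∀ c ∈ ℬ j, ∃ f : ((m : Fin n) → Fin (dv m)) → B,
    (∀ e, f e ∈ 𝒜 (j - ∑ m : Fin n, ((e m : ℕ) : ℤ))) ∧
    c = ∑ e : (m : Fin n) → Fin (dv m), (∏ m : Fin n, x m ^ ((e m : ℕ))) * φ (f e)
  eq_zero : ∀ (j : ℤ) (f : ((m : Fin n) → Fin (dv m)) → B),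
    (∀ e, f e ∈ 𝒜 (j - ∑ m : Fin n, ((e m : ℕ) : ℤ))) →
    (∑ e : (m : Fin n) → Fin (dv m), (∏ m : Fin n, x m ^ ((e m : ℕ))) * φ (f e)) = 0 →
    ∀ e, f e = 0

theorem IsCIExtension.isTruncSum {𝒜 : ℤ → Submodule k B} {ℬ : ℤ → Submodule k A}
    {φ : B →ₐ[k] A} {x : A} {d : ℕ} (h : IsCIExtension 𝒜 ℬ φ x d) : IsTruncSum 𝒜 ℬ φ x d :=
  ⟨h.x_pow, h.decomp_mem, h.decomp_exists, h.decomp_unique⟩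

theorem IsMultiCIExtension.isMultiTruncSum {n : ℕ} {𝒜 : ℤ → Submodule k B}
    {ℬ : ℤ → Submodule k A} {φ : B →ₐ[k] A} {x : Fin n → A} {dv : Fin n → ℕ}
    (h : IsMultiCIExtension 𝒜 ℬ φ x dv) : IsMultiTruncSum 𝒜 ℬ φ x dv :=
  ⟨h.x_pow, h.decomp_mem, h.decomp_exists, h.decomp_unique⟩

/-- The map `(f 0, f 1, …) ↦ ∑_{q<d} x^q · φ(f q)`. -/
def truncEval (φ : B →ₐ[k] A) (x : A) (d : ℕ) : (ℕ → B) →ₗ[k] A where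
  toFun f := ∑ q ∈ Finset.range d, x ^ q * φ (f q)
  map_add' f g := by simp [mul_add, Finset.sum_add_distrib]
  map_smul' c f := by simp [Finset.smul_sum]

theorem truncEval_comm (φ : B →ₐ[k] A) {x : A} {d : ℕ} (hx : x ^ d = 0) (ℓ : B) (f : ℕ → B) :
    truncEval φ x d (truncOp d (LinearMap.mulLeft k ℓ) f) =
      LinearMap.mulLeft k (φ ℓ + x) (truncEval φ x d f) := by
  have h1 : ∀ q ∈ Finset.range d, x ^ q * φ (truncOp d (LinearMap.mulLeft k ℓ) f q) =
      φ ℓ * (x ^ q * φ (f q)) + x ^ q * φ (shiftSeq f q) := by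
    intro q hq
    simp only [truncOp, LinearMap.coe_mk, AddHom.coe_mk, if_pos (Finset.mem_range.mp hq),
      LinearMap.mulLeft_apply, map_add, map_mul]
    ring
  have h2 : ∑ q ∈ Finset.range d, x ^ q * φ (shiftSeq f q) =
      ∑ q ∈ Finset.range d, x * (x ^ q * φ (f q)) := by
    rcases d with _ | d
    · simp
    · rw [Finset.sum_range_succ', Finset.sum_range_succ, ← mul_assoc x, ← pow_succ', hx]
      simp only [shiftSeq, map_zero, mul_zero, zero_mul, add_zero]
      exact Finset.sum_congr rfl fun q _ => by ring
  simp only [truncEval, LinearMap.coe_mk, AddHom.coe_mk, LinearMap.mulLeft_apply]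
  rw [Finset.sum_congr rfl h1, Finset.sum_add_distrib, h2, add_mul, Finset.mul_sum, Finset.mul_sum]

section

variable {𝒜 : ℤ → Submodule k B} {ℬ : ℤ → Submodule k A} {φ : B →ₐ[k] A} {x : A} {d : ℕ}

theorem IsTruncSum.truncEval_mem (h : IsTruncSum 𝒜 ℬ φ x d) (j : ℤ) {f : ℕ → B}
    (hf : f ∈ truncGrading d 𝒜 j) : truncEval φ x d f ∈ ℬ j := by
  simp only [truncEval, LinearMap.coe_mk, AddHom.coe_mk, Finset.sum_range]
  exact h.mem j (fun q => f q) fun q => hf.1 q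

theorem IsTruncSum.truncEval_eq_zero (h : IsTruncSum 𝒜 ℬ φ x d) (j : ℤ) {f : ℕ → B}
    (hf : f ∈ truncGrading d 𝒜 j) (h0 : truncEval φ x d f = 0) : f = 0 := by
  simp only [truncEval, LinearMap.coe_mk, AddHom.coe_mk, Finset.sum_range] at h0
  have := h.eq_zero j (fun q => f q) (fun q => hf.1 q) h0
  ext q
  by_cases hq : q < d
  · exact this ⟨q, hq⟩
  · exact hf.2 q (not_lt.mp hq)

theorem IsTruncSum.exists_truncEval_eq (h : IsTruncSum 𝒜 ℬ φ x d) (j : ℤ) {c : A}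
    (hc : c ∈ ℬ j) : ∃ f ∈ truncGrading d 𝒜 j, truncEval φ x d f = c := by
  obtain ⟨f, hf, rfl⟩ := h.exists_eq j c hc
  refine ⟨fun q => if hq : q < d then f ⟨q, hq⟩ else 0, ⟨fun q => ?_, fun q hq => ?_⟩, ?_⟩
  · dsimp only
    split_ifs with hq
    exacts [hf ⟨q, hq⟩, zero_mem _]
  · simp [Nat.not_lt.mpr hq]
  · simp [truncEval, Finset.sum_range]

theorem IsTruncSum.raisesDegree (h : IsTruncSum 𝒜 ℬ φ x d) {ℓ : B}
    (hℓ : RaisesDegree 𝒜 (LinearMap.mulLeft k ℓ)) :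
    RaisesDegree ℬ (LinearMap.mulLeft k (φ ℓ + x)) :=
  (hℓ.trunc d).of_quotient (truncEval_comm φ h.x_pow ℓ) (fun i _ => h.truncEval_mem i)
    fun i _ => h.exists_truncEval_eq i

theorem IsTruncSum.injAbout [CharZero k] (hd : 1 ≤ d) (h : IsTruncSum 𝒜 ℬ φ x d) {ℓ : B}
    (hℓ : RaisesDegree 𝒜 (LinearMap.mulLeft k ℓ)) {N : ℤ}
    (hN : InjAbout 𝒜 (LinearMap.mulLeft k ℓ) N) :
    InjAbout ℬ (LinearMap.mulLeft k (φ ℓ + x)) (N + (d - 1)) := by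
  obtain ⟨d, rfl⟩ := Nat.exists_eq_add_of_le' hd
  have := hN.trunc d
  rw [show N + (((d + 1 : ℕ) : ℤ) - 1) = N + d by push_cast; ring]
  exact this.of_equiv (truncEval_comm φ h.x_pow ℓ) (hℓ.trunc _)
    (fun i _ => h.truncEval_eq_zero i) fun i _ => h.exists_truncEval_eq i

theorem IsTruncSum.surjAbout [CharZero k] (hd : 1 ≤ d) (h : IsTruncSum 𝒜 ℬ φ x d) {ℓ : B}
    (hℓ : RaisesDegree 𝒜 (LinearMap.mulLeft k ℓ)) {N : ℤ}
    (hN : SurjAbout 𝒜 (LinearMap.mulLeft k ℓ) N) :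
    SurjAbout ℬ (LinearMap.mulLeft k (φ ℓ + x)) (N + (d - 1)) := by
  obtain ⟨d, rfl⟩ := Nat.exists_eq_add_of_le' hd
  have := hN.trunc hℓ d
  rw [show N + (((d + 1 : ℕ) : ℤ) - 1) = N + d by push_cast; ring]
  exact this.of_quotient (truncEval_comm φ h.x_pow ℓ) (fun i _ => h.truncEval_mem i)
    fun i _ => h.exists_truncEval_eq i

end

theorem sum_exponents_cons {n : ℕ} {dv : Fin (n + 1) → ℕ} (φ : B →ₐ[k] A) (x : Fin (n + 1) → A)
    (f : ((m : Fin (n + 1)) → Fin (dv m)) → B) :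
    ∑ e : (m : Fin (n + 1)) → Fin (dv m), (∏ m, x m ^ (e m : ℕ)) * φ (f e) =
      ∑ q : Fin (dv 0), x 0 ^ (q : ℕ) * ∑ e : (m : Fin n) → Fin (dv m.succ),
        (∏ m, x m.succ ^ (e m : ℕ)) * φ (f (Fin.cons q e)) := by
  rw [← (Fin.consEquiv fun m => Fin (dv m)).sum_comp, Fintype.sum_prod_type]
  refine Finset.sum_congr rfl fun q _ => ?_
  rw [Finset.mul_sum]
  refine Finset.sum_congr rfl fun e _ => ?_
  rw [Fin.prod_univ_succ]
  simp [Fin.consEquiv, mul_assoc]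

/-- The sum of the subspaces `x^e · φ(𝒜 (j - |e|))` over the exponent vectors `e` below `dv`. -/
def monomialSpan {n : ℕ} (𝒜 : ℤ → Submodule k B) (φ : B →ₐ[k] A) (x : Fin n → A)
    (dv : Fin n → ℕ) (j : ℤ) : Submodule k A where
  carrier := {c | ∃ f : ((m : Fin n) → Fin (dv m)) → B,
    (∀ e, f e ∈ 𝒜 (j - ∑ m : Fin n, ((e m : ℕ) : ℤ))) ∧
    c = ∑ e : (m : Fin n) → Fin (dv m), (∏ m : Fin n, x m ^ ((e m : ℕ))) * φ (f e)}
  add_mem' := by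
    rintro _ _ ⟨f, hf, rfl⟩ ⟨g, hg, rfl⟩
    exact ⟨f + g, fun e => add_mem (hf e) (hg e), by simp [mul_add, Finset.sum_add_distrib]⟩
  zero_mem' := ⟨0, fun _ => zero_mem _, by simp⟩
  smul_mem' := by
    rintro c _ ⟨f, hf, rfl⟩
    exact ⟨c • f, fun e => Submodule.smul_mem _ c (hf e), by simp [Finset.smul_sum]⟩

section

variable {n : ℕ} {𝒜 : ℤ → Submodule k B} {ℬ : ℤ → Submodule k A} {φ : B →ₐ[k] A}

theorem sum_cons_exponents {dv : Fin (n + 1) → ℕ} (j : ℤ) (q : Fin (dv 0))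
    (e : (m : Fin n) → Fin (dv m.succ)) :
    j - ∑ m, (((Fin.cons q e : (m : Fin (n + 1)) → Fin (dv m)) m : ℕ) : ℤ) =
      j - ((q : ℕ) : ℤ) - ∑ m, ((e m : ℕ) : ℤ) := by
  rw [Fin.sum_univ_succ]
  simp [sub_sub]

theorem IsMultiTruncSum.tail {x : Fin (n + 1) → A} {dv : Fin (n + 1) → ℕ} (hdv : ∀ m, 1 ≤ dv m)
    (h : IsMultiTruncSum 𝒜 ℬ φ x dv) :
    IsMultiTruncSum 𝒜 (monomialSpan 𝒜 φ (fun m : Fin n => x m.succ) fun m => dv m.succ) φ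
      (fun m : Fin n => x m.succ) fun m => dv m.succ := by
  refine ⟨fun m => h.x_pow _, fun j f hf => ⟨f, hf, rfl⟩, fun j c hc => hc, fun j f hf h0 e => ?_⟩
  have key := h.eq_zero j (fun e => if (e 0 : ℕ) = 0 then f (fun m => e m.succ) else 0) ?_ ?_
    (Fin.cons ⟨0, hdv 0⟩ e)
  · simpa using key
  · intro e
    induction e using Fin.consCases with | _ q e =>
    rw [sum_cons_exponents]
    simp only [Fin.cons_zero, Fin.cons_succ]
    split_ifs with hq
    · simpa [hq] using hf e
    · exact zero_mem _
  · rw [sum_exponents_cons]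
    refine Finset.sum_eq_zero fun q _ => ?_
    simp only [Fin.cons_zero, Fin.cons_succ]
    split_ifs with hq
    · rw [h0, mul_zero]
    · simp

theorem IsMultiTruncSum.head {x : Fin (n + 1) → A} {dv : Fin (n + 1) → ℕ}
    (h : IsMultiTruncSum 𝒜 ℬ φ x dv) :
    IsTruncSum (monomialSpan 𝒜 φ (fun m : Fin n => x m.succ) fun m => dv m.succ) ℬ
      (AlgHom.id k A) (x 0) (dv 0) := by
  have key : ∀ (j : ℤ) (f : Fin (dv 0) → A), (∀ q : Fin (dv 0), f q ∈
      monomialSpan 𝒜 φ (fun m : Fin n => x m.succ) (fun m => dv m.succ) (j - ((q : ℕ) : ℤ))) →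
      ∃ g : ((m : Fin (n + 1)) → Fin (dv m)) → B,
        (∀ e, g e ∈ 𝒜 (j - ∑ m : Fin (n + 1), ((e m : ℕ) : ℤ))) ∧
        ∀ q, f q = ∑ e : (m : Fin n) → Fin (dv m.succ),
          (∏ m, x m.succ ^ (e m : ℕ)) * φ (g (Fin.cons q e)) := by
    intro j f hf
    choose g hg hg' using hf
    refine ⟨fun e => g (e 0) fun m => e m.succ, fun e => ?_, fun q => by simp [hg' q]⟩
    induction e using Fin.consCases with | _ q e =>
    rw [sum_cons_exponents]
    exact hg q e
  refine ⟨h.x_pow 0, fun j f hf => ?_, fun j c hc => ?_, fun j f hf h0 q => ?_⟩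
  · obtain ⟨g, hg, hg'⟩ := key j f hf
    have := h.mem j g hg
    rw [sum_exponents_cons] at this
    simpa [hg'] using this
  · obtain ⟨g, hg, rfl⟩ := h.exists_eq j c hc
    refine ⟨fun q => ∑ e : (m : Fin n) → Fin (dv m.succ),
      (∏ m, x m.succ ^ (e m : ℕ)) * φ (g (Fin.cons q e)), fun q => ⟨_, fun e => ?_, rfl⟩, ?_⟩
    · rw [← sum_cons_exponents]
      exact hg _
    · rw [sum_exponents_cons]
      rfl
  · obtain ⟨g, hg, hg'⟩ := key j f hf
    have := h.eq_zero j g hg (by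
      rw [sum_exponents_cons, ← h0]
      exact Finset.sum_congr rfl fun q _ => by rw [hg' q]; rfl)
    rw [hg' q]
    simp [this]

theorem IsMultiTruncSum.lefschetz [CharZero k] {x : Fin n → A} {dv : Fin n → ℕ}
    (hdv : ∀ m, 1 ≤ dv m) (h : IsMultiTruncSum 𝒜 ℬ φ x dv) {ℓ : B}
    (hℓ : RaisesDegree 𝒜 (LinearMap.mulLeft k ℓ)) :
    RaisesDegree ℬ (LinearMap.mulLeft k (φ ℓ + ∑ m, x m)) ∧
    (∀ N, InjAbout 𝒜 (LinearMap.mulLeft k ℓ) N →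
      InjAbout ℬ (LinearMap.mulLeft k (φ ℓ + ∑ m, x m)) (N + ∑ m, ((dv m : ℤ) - 1))) ∧
    (∀ N, SurjAbout 𝒜 (LinearMap.mulLeft k ℓ) N →
      SurjAbout ℬ (LinearMap.mulLeft k (φ ℓ + ∑ m, x m)) (N + ∑ m, ((dv m : ℤ) - 1))) := by
  induction n generalizing ℬ with
  | zero =>
    have hc : ∀ v, φ.toLinearMap (LinearMap.mulLeft k ℓ v) =
      LinearMap.mulLeft k (φ ℓ + ∑ m, x m) (φ.toLinearMap v) := by simp
    have hmem : ∀ i, ∀ v ∈ 𝒜 i, φ.toLinearMap v ∈ ℬ i := fun i v hv => by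
      simpa using h.mem i (fun _ => v) (by simpa using hv)
    have hinj : ∀ i, ∀ v ∈ 𝒜 i, φ.toLinearMap v = 0 → v = 0 := fun i v hv h0 =>
      h.eq_zero i (fun _ => v) (by simpa using hv) (by simpa using h0) default
    have hsurj : ∀ i, ∀ w ∈ ℬ i, ∃ v ∈ 𝒜 i, φ.toLinearMap v = w := fun i w hw => by
      obtain ⟨f, hf, rfl⟩ := h.exists_eq i w hw
      exact ⟨f default, by simpa using hf default, by simp⟩
    refine ⟨hℓ.of_quotient hc hmem hsurj, fun N hN => ?_, fun N hN => ?_⟩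
    · simpa using hN.of_equiv hc hℓ hinj hsurj
    · simpa using hN.of_quotient hc hmem hsurj
  | succ n ih =>
    obtain ⟨h1, h2, h3⟩ := ih (fun m => hdv m.succ) (h.tail hdv)
    have hsum : φ ℓ + ∑ m, x m = AlgHom.id k A (φ ℓ + ∑ m : Fin n, x m.succ) + x 0 := by
      rw [Fin.sum_univ_succ, AlgHom.id_apply]
      ring
    have hN : ∀ N : ℤ, N + ∑ m, ((dv m : ℤ) - 1) =
        N + ∑ m : Fin n, ((dv m.succ : ℤ) - 1) + (dv 0 - 1) := fun N => by
      rw [Fin.sum_univ_succ]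
      ring
    simp only [hsum, hN]
    exact ⟨h.head.raisesDegree h1, fun N hI => h.head.injAbout (hdv 0) h1 (h2 N hI),
      fun N hS => h.head.surjAbout (hdv 0) h1 (h3 N hS)⟩

end

end Decompositions

section LefschetzElements

variable {k B : Type*} [Field k] [CommRing B] [Algebra k B]

section

variable [FiniteDimensional k B] {V W : Submodule k B} {a : B}

theorem MulInjOn.finrank_le (h : MulInjOn V a) (hVW : ∀ v ∈ V, a * v ∈ W) :
    Module.finrank k V ≤ Module.finrank k W := by
  refine LinearMap.finrank_le_finrank_of_injective
    (f := (LinearMap.mulLeft k a).restrict (p := V) (q := W) hVW) ?_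
  rw [← LinearMap.ker_eq_bot, LinearMap.ker_eq_bot']
  exact fun v hv => Subtype.ext (h v v.2 (congrArg Subtype.val hv))

theorem MulSurjOnto.finrank_le (h : MulSurjOnto V W a) :
    Module.finrank k W ≤ Module.finrank k V := by
  have hle : W ≤ V.map (LinearMap.mulLeft k a) := fun w hw => by
    obtain ⟨v, hv, rfl⟩ := h w hw
    exact ⟨v, hv, rfl⟩
  exact (Submodule.finrank_mono hle).trans (Submodule.finrank_map_le _ _)

theorem MulSurjOnto.mulInjOn (h : MulSurjOnto V W a) (hVW : ∀ v ∈ V, a * v ∈ W)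
    (hd : Module.finrank k V ≤ Module.finrank k W) : MulInjOn V a := by
  have he : Module.finrank k V = Module.finrank k W := le_antisymm hd h.finrank_le
  have hs : Function.Surjective ((LinearMap.mulLeft k a).restrict (p := V) (q := W) hVW) := by
    rintro ⟨w, hw⟩
    obtain ⟨v, hv, hv'⟩ := h w hw
    exact ⟨⟨v, hv⟩, Subtype.ext hv'⟩
  have hi := (LinearMap.injective_iff_surjective_of_finrank_eq_finrank he).mpr hs
  intro v hv h0
  have := @hi ⟨v, hv⟩ 0 ((Subtype.ext h0).trans (map_zero _).symm)
  simpa using congrArg Subtype.val this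

theorem MulInjOn.mulSurjOnto (h : MulInjOn V a) (hVW : ∀ v ∈ V, a * v ∈ W)
    (hd : Module.finrank k W ≤ Module.finrank k V) : MulSurjOnto V W a := by
  have he : Module.finrank k V = Module.finrank k W := le_antisymm (h.finrank_le hVW) hd
  have hi : Function.Injective ((LinearMap.mulLeft k a).restrict (p := V) (q := W) hVW) := by
    rw [← LinearMap.ker_eq_bot, LinearMap.ker_eq_bot']
    exact fun v hv => Subtype.ext (h v v.2 (congrArg Subtype.val hv))
  have hs := (LinearMap.injective_iff_surjective_of_finrank_eq_finrank he).mp hi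
  intro w hw
  obtain ⟨v, hv⟩ := hs ⟨w, hw⟩
  exact ⟨v, v.2, congrArg Subtype.val hv⟩

theorem MulFullRank.mulInjOn (h : MulFullRank V W a) (hVW : ∀ v ∈ V, a * v ∈ W)
    (hd : Module.finrank k V ≤ Module.finrank k W) : MulInjOn V a :=
  h.elim id fun h => h.mulInjOn hVW hd

theorem MulFullRank.mulSurjOnto (h : MulFullRank V W a) (hVW : ∀ v ∈ V, a * v ∈ W)
    (hd : Module.finrank k W ≤ Module.finrank k V) : MulSurjOnto V W a :=
  h.elim (fun h => h.mulSurjOnto hVW hd) id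

end

theorem mulInjOn_one (V : Submodule k B) : MulInjOn V (1 : B) := fun v _ h => by simpa using h

theorem mulSurjOnto_one (V : Submodule k B) : MulSurjOnto V V (1 : B) :=
  fun w hw => ⟨w, hw, one_mul w⟩

/-- Every power of `ℓ` has full rank in every degree. -/
def IsStrongLefschetz (𝒜 : ℤ → Submodule k B) (ℓ : B) : Prop :=
  ∀ (i : ℤ) (t : ℕ), MulFullRank (𝒜 i) (𝒜 (i + t)) (ℓ ^ t)

/-- For each `N`, the maps `ℓ ^ t : 𝒜 i → 𝒜 (i + t)` with `2 * i + t = N` are all injective or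
all surjective. -/
def IsBalancedLefschetz (𝒜 : ℤ → Submodule k B) (ℓ : B) : Prop :=
  ∀ N, InjAbout 𝒜 (LinearMap.mulLeft k ℓ) N ∨ SurjAbout 𝒜 (LinearMap.mulLeft k ℓ) N

variable {𝒜 : ℤ → Submodule k B} {ℓ : B}

theorem injAbout_mulLeft_iff {N : ℤ} : InjAbout 𝒜 (LinearMap.mulLeft k ℓ) N ↔
    ∀ (i : ℤ) (t : ℕ), 2 * i + t = N → MulInjOn (𝒜 i) (ℓ ^ t) := by
  simp only [InjAbout, MulInjOn, LinearMap.pow_mulLeft, LinearMap.mulLeft_apply]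

theorem surjAbout_mulLeft_iff {N : ℤ} : SurjAbout 𝒜 (LinearMap.mulLeft k ℓ) N ↔
    ∀ (i : ℤ) (t : ℕ), 2 * i + t = N → MulSurjOnto (𝒜 i) (𝒜 (i + t)) (ℓ ^ t) := by
  simp only [SurjAbout, MulSurjOnto, LinearMap.pow_mulLeft, LinearMap.mulLeft_apply]

theorem IsBalancedLefschetz.isStrongLefschetz (h : IsBalancedLefschetz 𝒜 ℓ) :
    IsStrongLefschetz 𝒜 ℓ := fun i t =>
  (h (2 * i + t)).imp (fun h => injAbout_mulLeft_iff.mp h i t rfl)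
    fun h => surjAbout_mulLeft_iff.mp h i t rfl

theorem not_isBalancedLefschetz (h : ¬ IsBalancedLefschetz 𝒜 ℓ) :
    ∃ (i i' : ℤ) (t t' : ℕ), 2 * i + t = 2 * i' + t' ∧ ¬ MulInjOn (𝒜 i) (ℓ ^ t) ∧
      ¬ MulSurjOnto (𝒜 i') (𝒜 (i' + t')) (ℓ ^ t') := by
  simp only [IsBalancedLefschetz, not_forall, not_or, injAbout_mulLeft_iff,
    surjAbout_mulLeft_iff] at h
  obtain ⟨N, ⟨i, t, h1, h2⟩, i', t', h3, h4⟩ := h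
  exact ⟨i, i', t, t', h1.trans h3.symm, h2, h4⟩

theorem IsStdGradedArtinian.pow_mul_mem (hB : IsStdGradedArtinian k B 𝒜) (hℓ : ℓ ∈ 𝒜 1) (t : ℕ)
    {i : ℤ} {v : B} (hv : v ∈ 𝒜 i) : ℓ ^ t * v ∈ 𝒜 (i + t) := by
  induction t with
  | zero => simpa using hv
  | succ t ih =>
    rw [pow_succ', mul_assoc, show i + ((t + 1 : ℕ) : ℤ) = 1 + (i + t) by push_cast; ring]
    exact hB.mul_mem hℓ ih

theorem IsStdGradedArtinian.raisesDegree (hB : IsStdGradedArtinian k B 𝒜) (hℓ : ℓ ∈ 𝒜 1) :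
    RaisesDegree 𝒜 (LinearMap.mulLeft k ℓ) := fun i v hv => by
  rw [LinearMap.mulLeft_apply, add_comm]
  exact hB.mul_mem hℓ hv

theorem IsStdGradedArtinian.mulInjOn_of_neg (hB : IsStdGradedArtinian k B 𝒜) {i : ℤ} (hi : i < 0)
    (a : B) : MulInjOn (𝒜 i) a := fun v hv _ => by
  rw [hB.neg_bot i hi] at hv
  exact hv

theorem mulSurjOnto_of_eq_bot {V W : Submodule k B} (hW : W = ⊥) (a : B) : MulSurjOnto V W a := by
  rintro w hw
  obtain rfl : w = 0 := by simpa [hW] using hw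
  exact ⟨0, zero_mem _, mul_zero a⟩

theorem HasSLP.exists_isStrongLefschetz (hB : IsStdGradedArtinian k B 𝒜) (h : HasSLP 𝒜) :
    ∃ ℓ ∈ 𝒜 1, IsStrongLefschetz 𝒜 ℓ := by
  obtain ⟨ℓ, hℓ, h⟩ := h
  refine ⟨ℓ, hℓ, fun i t => ?_⟩
  rcases lt_or_ge i 0 with hi | hi
  · exact Or.inl (hB.mulInjOn_of_neg hi _)
  · rcases Nat.eq_zero_or_pos t with rfl | ht
    · left
      rw [pow_zero]
      exact mulInjOn_one _
    · exact h i hi t ht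

theorem IsStrongLefschetz.hasSLP (h : IsStrongLefschetz 𝒜 ℓ) (hℓ : ℓ ∈ 𝒜 1) : HasSLP 𝒜 :=
  ⟨ℓ, hℓ, fun i _ t _ => h i t⟩

theorem HasSLP.hasWLP (h : HasSLP 𝒜) : HasWLP 𝒜 := by
  obtain ⟨ℓ, hℓ, h⟩ := h
  exact ⟨ℓ, hℓ, fun i hi => by simpa using h i hi 1 le_rfl⟩

theorem IsBalancedLefschetz.almostCentered (hB : IsStdGradedArtinian k B 𝒜) (hℓ : ℓ ∈ 𝒜 1)
    (h : IsBalancedLefschetz 𝒜 ℓ) : AlmostCentered 𝒜 := by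
  have := hB.finiteDim
  intro i j hij
  obtain ⟨t, ht⟩ : ∃ t : ℕ, j = i + t := ⟨(j - i).toNat, by omega⟩
  subst ht
  rcases h (2 * i + t) with h | h
  · rw [injAbout_mulLeft_iff] at h
    have key : ∀ s : ℕ, hilb 𝒜 (i - s) ≤ hilb 𝒜 (i + t + s) := fun s => by
      refine (h (i - s) (t + 2 * s) (by push_cast; ring)).finrank_le fun v hv => ?_
      have := hB.pow_mul_mem hℓ (t + 2 * s) hv
      rwa [show i - s + ((t + 2 * s : ℕ) : ℤ) = i + t + s by push_cast; ring] at this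
    exact ⟨fun _ => key, fun hlt => absurd hlt (by simpa using key 0)⟩
  · rw [surjAbout_mulLeft_iff] at h
    have key : ∀ s : ℕ, hilb 𝒜 (i + t + s) ≤ hilb 𝒜 (i - s) := fun s => by
      have := (h (i - s) (t + 2 * s) (by push_cast; ring)).finrank_le
      rwa [show i - s + ((t + 2 * s : ℕ) : ℤ) = i + t + s by push_cast; ring] at this
    exact ⟨fun hlt => absurd hlt (by simpa using key 0), fun _ => key⟩

theorem IsStrongLefschetz.isBalancedLefschetz (hB : IsStdGradedArtinian k B 𝒜) (hℓ : ℓ ∈ 𝒜 1)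
    (h : IsStrongLefschetz 𝒜 ℓ) (hc : AlmostCentered 𝒜) : IsBalancedLefschetz 𝒜 ℓ := by
  have := hB.finiteDim
  by_contra hP
  obtain ⟨i, i', t, t', hN, hI, hS⟩ := not_isBalancedLefschetz hP
  have h1 : hilb 𝒜 (i + t) < hilb 𝒜 i := lt_of_not_ge fun hle =>
    hI ((h i t).mulInjOn (fun v => hB.pow_mul_mem hℓ t) hle)
  have h2 : hilb 𝒜 i' < hilb 𝒜 (i' + t') := lt_of_not_ge fun hle =>
    hS ((h i' t').mulSurjOnto (fun v => hB.pow_mul_mem hℓ t') hle)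
  have ht : t ≠ 0 := by rintro rfl; simp at h1
  have ht' : t' ≠ 0 := by rintro rfl; simp at h2
  rcases le_total i i' with hle | hle
  · have := (hc i' (i' + t') (by omega)).1 h2 (i' - i).toNat
    rw [show i' - ((i' - i).toNat : ℤ) = i by omega,
      show i' + t' + ((i' - i).toNat : ℤ) = i + t by omega] at this
    omega
  · have := (hc i (i + t) (by omega)).2 h1 (i - i').toNat
    rw [show i - ((i - i').toNat : ℤ) = i' by omega,
      show i + t + ((i - i').toNat : ℤ) = i' + t' by omega] at this
    omega

theorem almostCentered_and_hasSLP_iff (hB : IsStdGradedArtinian k B 𝒜) :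
    (AlmostCentered 𝒜 ∧ HasSLP 𝒜) ↔ ∃ ℓ ∈ 𝒜 1, IsBalancedLefschetz 𝒜 ℓ := by
  constructor
  · rintro ⟨hc, hS⟩
    obtain ⟨ℓ, hℓ, h⟩ := hS.exists_isStrongLefschetz hB
    exact ⟨ℓ, hℓ, h.isBalancedLefschetz hB hℓ hc⟩
  · rintro ⟨ℓ, hℓ, h⟩
    exact ⟨h.almostCentered hB hℓ, h.isStrongLefschetz.hasSLP hℓ⟩

section

variable {D : ℕ}

theorem IsBalancedLefschetz.hilb_chain (hB : IsStdGradedArtinian k B 𝒜) (hℓ : ℓ ∈ 𝒜 1)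
    (hsocle : 𝒜 (D : ℤ) ≠ ⊥) (htop : ∀ j : ℤ, (D : ℤ) < j → 𝒜 j = ⊥)
    (h : IsBalancedLefschetz 𝒜 ℓ) :
    (∀ i : ℕ, i ≤ D / 2 → hilb 𝒜 ((i : ℤ) - 1) ≤ hilb 𝒜 ((D : ℤ) - i) ∧
        hilb 𝒜 ((D : ℤ) - i) ≤ hilb 𝒜 (i : ℤ)) ∨
      (∀ i : ℕ, i ≤ D / 2 → hilb 𝒜 ((D : ℤ) - i + 1) ≤ hilb 𝒜 (i : ℤ) ∧
        hilb 𝒜 (i : ℤ) ≤ hilb 𝒜 ((D : ℤ) - i)) := by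
  have := hB.finiteDim
  have hinj : ∀ (N i j : ℤ), InjAbout 𝒜 (LinearMap.mulLeft k ℓ) N → i + j = N → i ≤ j →
      hilb 𝒜 i ≤ hilb 𝒜 j := by
    intro N i j hN hij hle
    refine (injAbout_mulLeft_iff.mp hN i (j - i).toNat (by omega)).finrank_le fun v hv => ?_
    have := hB.pow_mul_mem hℓ (j - i).toNat hv
    rwa [show i + ((j - i).toNat : ℤ) = j by omega] at this
  have hsurj : ∀ (N i j : ℤ), SurjAbout 𝒜 (LinearMap.mulLeft k ℓ) N → i + j = N → i ≤ j →
      hilb 𝒜 j ≤ hilb 𝒜 i := by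
    intro N i j hN hij hle
    have := (surjAbout_mulLeft_iff.mp hN i (j - i).toNat (by omega)).finrank_le
    rwa [show i + ((j - i).toNat : ℤ) = j by omega] at this
  have hone : (1 : B) ≠ 0 := fun h10 => hsocle <| by
    rw [eq_bot_iff]
    intro v _
    rw [Submodule.mem_bot, ← one_mul v, h10, zero_mul]
  rcases h D with hD | hD
  · right
    have hD' : SurjAbout 𝒜 (LinearMap.mulLeft k ℓ) (D + 1) := by
      refine (h _).resolve_left fun hI => hone ?_
      refine injAbout_mulLeft_iff.mp hI 0 (D + 1) (by push_cast; ring) 1 hB.one_mem ?_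
      have := hB.pow_mul_mem hℓ (D + 1) hB.one_mem
      rw [htop _ (by push_cast; omega)] at this
      exact this
    exact fun i hi => ⟨hsurj _ _ _ hD' (by ring) (by omega), hinj _ _ _ hD (by ring) (by omega)⟩
  · left
    have hD' : InjAbout 𝒜 (LinearMap.mulLeft k ℓ) (D - 1) := by
      refine (h _).resolve_right fun hS => hsocle ?_
      rw [eq_bot_iff]
      intro w hw
      obtain ⟨v, hv, rfl⟩ := surjAbout_mulLeft_iff.mp hS (-1) (D + 1) (by push_cast; ring) w
        (by convert hw using 2; push_cast; ring)
      rw [hB.neg_bot _ (by norm_num), Submodule.mem_bot] at hv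
      simp [hv]
    exact fun i hi => ⟨hinj _ _ _ hD' (by ring) (by omega), hsurj _ _ _ hD (by ring) (by omega)⟩

theorem IsStrongLefschetz.isBalancedLefschetz_of_hilb_chain (hB : IsStdGradedArtinian k B 𝒜)
    (hℓ : ℓ ∈ 𝒜 1) (htop : ∀ j : ℤ, (D : ℤ) < j → 𝒜 j = ⊥) (h : IsStrongLefschetz 𝒜 ℓ)
    (hc : (∀ i : ℕ, i ≤ D / 2 → hilb 𝒜 ((i : ℤ) - 1) ≤ hilb 𝒜 ((D : ℤ) - i) ∧
        hilb 𝒜 ((D : ℤ) - i) ≤ hilb 𝒜 (i : ℤ)) ∨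
      (∀ i : ℕ, i ≤ D / 2 → hilb 𝒜 ((D : ℤ) - i + 1) ≤ hilb 𝒜 (i : ℤ) ∧
        hilb 𝒜 (i : ℤ) ≤ hilb 𝒜 ((D : ℤ) - i))) : IsBalancedLefschetz 𝒜 ℓ := by
  have := hB.finiteDim
  have hinj : ∀ N : ℤ, (∀ (i : ℕ) (t : ℕ), 2 * (i : ℤ) + t = N → 1 ≤ t →
      hilb 𝒜 i ≤ hilb 𝒜 (i + t)) → InjAbout 𝒜 (LinearMap.mulLeft k ℓ) N := by
    intro N hN
    rw [injAbout_mulLeft_iff]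
    intro i t hit
    rcases lt_or_ge i 0 with hi | hi
    · exact hB.mulInjOn_of_neg hi _
    lift i to ℕ using hi
    rcases Nat.eq_zero_or_pos t with rfl | ht
    · rw [pow_zero]
      exact mulInjOn_one _
    · exact (h i t).mulInjOn (fun v => hB.pow_mul_mem hℓ t) (hN i t hit ht)
  have hsurj : ∀ N : ℤ, (D : ℤ) ≤ N → (∀ (i : ℕ) (t : ℕ), 2 * (i : ℤ) + t = N → 1 ≤ t →
      hilb 𝒜 (i + t) ≤ hilb 𝒜 i) → SurjAbout 𝒜 (LinearMap.mulLeft k ℓ) N := by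
    intro N hDN hN
    rw [surjAbout_mulLeft_iff]
    intro i t hit
    rcases lt_or_ge i 0 with hi | hi
    · exact mulSurjOnto_of_eq_bot (htop _ (by omega)) _
    lift i to ℕ using hi
    rcases Nat.eq_zero_or_pos t with rfl | ht
    · rw [pow_zero, Nat.cast_zero, add_zero]
      exact mulSurjOnto_one _
    · exact (h i t).mulSurjOnto (fun v => hB.pow_mul_mem hℓ t) (hN i t hit ht)
  intro N
  rcases hc with hc | hc
  · rcases le_or_gt (D : ℤ) N with hN | hN
    · refine Or.inr (SurjAbout.mono (hB.raisesDegree hℓ) (hsurj D le_rfl fun i t hit ht => ?_) hN)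
      rw [show (i : ℤ) + t = D - i by omega]
      exact (hc i (by omega)).2
    · refine Or.inl (InjAbout.mono (hinj (D - 1) fun i t hit ht => ?_) (by omega))
      have := (hc (i + 1) (by omega)).1
      rwa [show ((i + 1 : ℕ) : ℤ) - 1 = i by push_cast; ring,
        show (D : ℤ) - ((i + 1 : ℕ) : ℤ) = i + t by push_cast; omega] at this
  · rcases le_or_gt N (D : ℤ) with hN | hN
    · refine Or.inl (InjAbout.mono (hinj D fun i t hit ht => ?_) hN)
      rw [show (i : ℤ) + t = D - i by omega]
      exact (hc i (by omega)).2
    · refine Or.inr (SurjAbout.mono (hB.raisesDegree hℓ)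
        (hsurj (D + 1) (by omega) fun i t hit ht => ?_) (by omega))
      rw [show (i : ℤ) + t = D - i + 1 by omega]
      exact (hc i (by omega)).1

end

end LefschetzElements

section LefschetzExtensions

variable {k B A : Type*} [Field k] [CharZero k] [CommRing B] [Algebra k B] [CommRing A]
  [Algebra k A] {𝒜 : ℤ → Submodule k B} {ℬ : ℤ → Submodule k A} {φ : B →ₐ[k] A} {ℓ : B}

theorem IsBalancedLefschetz.extend {x : A} {d : ℕ} (hB : IsStdGradedArtinian k B 𝒜)
    (hℓ : ℓ ∈ 𝒜 1) (h : IsBalancedLefschetz 𝒜 ℓ) (hd : 1 ≤ d) (hx : IsCIExtension 𝒜 ℬ φ x d) :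
    HasSLP ℬ := by
  have hP : IsBalancedLefschetz ℬ (φ ℓ + x) := fun N => by
    have h1 := fun h => hx.isTruncSum.injAbout hd (hB.raisesDegree hℓ) (N := N - (d - 1)) h
    have h2 := fun h => hx.isTruncSum.surjAbout hd (hB.raisesDegree hℓ) (N := N - (d - 1)) h
    rw [sub_add_cancel] at h1 h2
    exact (h _).imp h1 h2
  exact hP.isStrongLefschetz.hasSLP (add_mem (hx.map_mem 1 ℓ hℓ) hx.x_mem)

theorem IsBalancedLefschetz.extend_multi {n : ℕ} {x : Fin n → A} {dv : Fin n → ℕ}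
    (hB : IsStdGradedArtinian k B 𝒜) (hℓ : ℓ ∈ 𝒜 1) (h : IsBalancedLefschetz 𝒜 ℓ)
    (hd : ∀ m, 1 ≤ dv m) (hx : IsMultiCIExtension 𝒜 ℬ φ x dv) : HasSLP ℬ := by
  have hP : IsBalancedLefschetz ℬ (φ ℓ + ∑ m, x m) := fun N => by
    obtain ⟨-, h1, h2⟩ := hx.isMultiTruncSum.lefschetz hd (hB.raisesDegree hℓ)
    have h1 := h1 (N - ∑ m, ((dv m : ℤ) - 1))
    have h2 := h2 (N - ∑ m, ((dv m : ℤ) - 1))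
    rw [sub_add_cancel] at h1 h2
    exact (h _).imp h1 h2
  exact hP.isStrongLefschetz.hasSLP
    (add_mem (hx.map_mem 1 ℓ hℓ) (sum_mem fun m _ => hx.x_mem m))

end LefschetzExtensions

section Construction

open Polynomial

variable {k B A : Type*} [Field k] [CommRing B] [Algebra k B] [CommRing A] [Algebra k A]
  {𝒜 : ℤ → Submodule k B}

/-- The homogeneous polynomials of degree `j` over a graded algebra, where the variable has
degree one. -/
def homogPoly (𝒜 : ℤ → Submodule k B) (j : ℤ) : Submodule k B[X] where
  carrier := {p | ∀ q : ℕ, p.coeff q ∈ 𝒜 (j - q)}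
  add_mem' ha hb q := by
    rw [coeff_add]
    exact add_mem (ha q) (hb q)
  zero_mem' q := by simp
  smul_mem' c p hp q := by
    rw [coeff_smul]
    exact Submodule.smul_mem _ c (hp q)

theorem X_pow_mul_C_mem_homogPoly {j : ℤ} {q : ℕ} {b : B} (hb : b ∈ 𝒜 (j - q)) :
    X ^ q * C b ∈ homogPoly 𝒜 j := by
  intro r
  rw [X_pow_mul, coeff_C_mul_X_pow]
  split_ifs with h
  · rwa [h]
  · exact zero_mem _

theorem mul_mem_homogPoly (hB : IsStdGradedArtinian k B 𝒜) {i j : ℤ} {p p' : B[X]}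
    (hp : p ∈ homogPoly 𝒜 i) (hp' : p' ∈ homogPoly 𝒜 j) : p * p' ∈ homogPoly 𝒜 (i + j) := by
  intro q
  rw [coeff_mul]
  refine sum_mem fun a ha => ?_
  have := hB.mul_mem (hp a.1) (hp' a.2)
  rwa [show i - (a.1 : ℤ) + (j - a.2) = i + j - q by
    rw [← Finset.HasAntidiagonal.mem_antidiagonal.mp ha]; push_cast; ring] at this

/-- The grading on a quotient of `B[x]`. -/
noncomputable def quotGrading (𝒜 : ℤ → Submodule k B) (π : B[X] →ₐ[k] A) (j : ℤ) : Submodule k A :=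
  (homogPoly 𝒜 j).map π.toLinearMap

/-- The map from the coefficients to a quotient of `B[x]`. -/
noncomputable def quotMap (π : B[X] →ₐ[k] A) : B →ₐ[k] A := π.comp CAlgHom

theorem quotMap_apply (π : B[X] →ₐ[k] A) (b : B) : quotMap π b = π (C b) := rfl

theorem sum_quotMap (π : B[X] →ₐ[k] A) {d : ℕ} (f : Fin d → B) :
    ∑ q : Fin d, π X ^ (q : ℕ) * quotMap π (f q) = π (∑ q : Fin d, X ^ (q : ℕ) * C (f q)) := by
  simp only [quotMap_apply, map_sum, map_mul, map_pow]

theorem coeff_sum_X_pow_mul_C {d : ℕ} (f : Fin d → B) (q : Fin d) :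
    (∑ r : Fin d, X ^ (r : ℕ) * C (f r)).coeff q = f q := by
  simp_rw [finsetSum_coeff, X_pow_mul, coeff_C_mul_X_pow, Fin.val_inj]
  simp

variable {π : B[X] →ₐ[k] A} {d : ℕ}

theorem quot_eq_sum (hX : π X ^ d = 0) (p : B[X]) :
    π p = ∑ q : Fin d, π X ^ (q : ℕ) * quotMap π (p.coeff q) := by
  have hdvd : X ^ d ∣ p - ∑ q : Fin d, X ^ (q : ℕ) * C (p.coeff q) := by
    rw [X_pow_dvd_iff]
    intro q hq
    rw [coeff_sub, coeff_sum_X_pow_mul_C (fun q : Fin d => p.coeff q) ⟨q, hq⟩, sub_self]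
  obtain ⟨r, hr⟩ := hdvd
  rw [sum_quotMap, ← sub_eq_zero, ← map_sub, hr, map_mul, map_pow, hX, zero_mul]

theorem isCIExtension_quot (hB : IsStdGradedArtinian k B 𝒜) (hker : ∀ p, π p = 0 ↔ X ^ d ∣ p) :
    IsCIExtension 𝒜 (quotGrading 𝒜 π) (quotMap π) (π X) d where
  map_mem j b hb := ⟨C b, by
    have := X_pow_mul_C_mem_homogPoly (𝒜 := 𝒜) (j := j) (q := 0) (b := b) (by simpa using hb)
    simpa using this, rfl⟩
  x_mem := ⟨X, by
    have := X_pow_mul_C_mem_homogPoly (𝒜 := 𝒜) (j := 1) (q := 1) (b := 1)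
      (by simpa using hB.one_mem)
    simpa using this, rfl⟩
  x_pow := by rw [← map_pow, hker]
  decomp_mem j f hf := by
    rw [sum_quotMap]
    exact ⟨_, sum_mem fun q _ => X_pow_mul_C_mem_homogPoly (hf q), rfl⟩
  decomp_exists := by
    rintro j _ ⟨p, hp, rfl⟩
    exact ⟨fun q => p.coeff q, fun q => hp q, quot_eq_sum (by rw [← map_pow, hker]) p⟩
  decomp_unique j f hf h0 q := by
    rw [sum_quotMap, hker, X_pow_dvd_iff] at h0
    rw [← coeff_sum_X_pow_mul_C f q, h0 q q.2]

theorem isStdGradedArtinian_quot (hB : IsStdGradedArtinian k B 𝒜)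
    (hπ : Function.Surjective π) (hker : ∀ p, π p = 0 ↔ X ^ d ∣ p) :
    IsStdGradedArtinian k A (quotGrading 𝒜 π) := by
  have hci := isCIExtension_quot hB hker
  have hmul : ∀ {i j : ℤ} {a b : A}, a ∈ quotGrading 𝒜 π i → b ∈ quotGrading 𝒜 π j →
      a * b ∈ quotGrading 𝒜 π (i + j) := by
    rintro i j _ _ ⟨p, hp, rfl⟩ ⟨p', hp', rfl⟩
    exact ⟨p * p', mul_mem_homogPoly hB hp hp', map_mul π p p'⟩
  have hone : (1 : A) ∈ quotGrading 𝒜 π 0 := by simpa using hci.map_mem 0 1 hB.one_mem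
  refine ⟨?_, hone, hmul, fun i hi => ?_, ?_, fun i hi => ?_, ?_⟩
  · rw [DirectSum.isInternal_submodule_iff_iSupIndep_and_iSup_eq_top]
    obtain ⟨hind, htop⟩ :=
      (DirectSum.isInternal_submodule_iff_iSupIndep_and_iSup_eq_top _).mp hB.internal
    constructor
    · rw [iSupIndep_iff_finsetSum_eq_zero_imp_eq_zero]
      intro s v hv h0
      choose! p hp hpv using hv
      rw [← Finset.sum_congr rfl hpv, ← map_sum] at h0
      have h1 := X_pow_dvd_iff.mp ((hker _).mp h0)
      intro i hi
      rw [← hpv i hi]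
      refine (hker _).mpr (X_pow_dvd_iff.mpr fun q hq => ?_)
      have h2 := hind.comp (sub_left_injective (b := (q : ℤ)))
      rw [iSupIndep_iff_finsetSum_eq_zero_imp_eq_zero] at h2
      refine h2 s (fun i => (p i).coeff q) (fun i hi => hp i hi q) ?_ i hi
      rw [← finsetSum_coeff]
      exact h1 q hq
    · rw [eq_top_iff]
      rintro c -
      obtain ⟨p, rfl⟩ := hπ c
      rw [quot_eq_sum hci.x_pow p]
      refine sum_mem fun q _ => ?_
      have : p.coeff q ∈ ⨆ i, 𝒜 i := htop ▸ Submodule.mem_top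
      refine Submodule.iSup_induction 𝒜
        (motive := fun b => π X ^ (q : ℕ) * quotMap π b ∈ iSup (quotGrading 𝒜 π)) this
        (fun i b hb => ?_) (by simp) fun a b ha hb => ?_
      · refine Submodule.mem_iSup_of_mem (i + q)
          ⟨_, X_pow_mul_C_mem_homogPoly (q := q) (b := b) (by simpa using hb), ?_⟩
        simp only [AlgHom.toLinearMap_apply, map_mul, map_pow, quotMap_apply]
      · rw [map_add, mul_add]
        exact add_mem ha hb
  · rw [eq_bot_iff]
    rintro _ ⟨p, hp, rfl⟩
    have : p = 0 := by
      ext q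
      have := hp q
      rw [hB.neg_bot _ (by omega)] at this
      exact this
    simp [this]
  · refine le_antisymm ?_ (Submodule.span_le.mpr (Set.singleton_subset_iff.mpr hone))
    rintro _ ⟨p, hp, rfl⟩
    have h0 := hp 0
    rw [Nat.cast_zero, sub_zero, hB.zero_spanOne, Submodule.mem_span_singleton] at h0
    obtain ⟨c, hc⟩ := h0
    refine Submodule.mem_span_singleton.mpr ⟨c, ?_⟩
    have : p = c • 1 := by
      ext q
      rcases q with _ | q
      · simp [← hc]
      · have := hp (q + 1)
        rw [hB.neg_bot _ (by push_cast; omega), Submodule.mem_bot] at this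
        rw [this, coeff_smul, coeff_one, if_neg (by omega), smul_zero]
    simp [this]
  · refine le_antisymm ?_ (Submodule.mul_le.mpr fun a ha b hb => add_comm i 1 ▸ hmul ha hb)
    intro c hc
    obtain ⟨f, hf, rfl⟩ := hci.decomp_exists _ c hc
    refine sum_mem ?_
    rintro ⟨q, hq⟩ -
    have hfq := hf ⟨q, hq⟩
    rcases q with _ | q
    · rw [Nat.cast_zero, sub_zero, hB.succ_eq i hi] at hfq
      have h1 := Submodule.mem_map_of_mem (f := (quotMap π).toLinearMap) hfq
      rw [Submodule.map_mul] at h1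
      rw [pow_zero, one_mul]
      have hle : ∀ j, (𝒜 j).map (quotMap π).toLinearMap ≤ quotGrading 𝒜 π j := fun j => by
        rintro _ ⟨b, hb, rfl⟩
        exact hci.map_mem j b hb
      exact mul_le_mul' (hle 1) (hle i) h1
    · rw [pow_succ', mul_assoc]
      refine Submodule.mul_mem_mul hci.x_mem ⟨_, X_pow_mul_C_mem_homogPoly (q := q)
        (b := f ⟨q + 1, hq⟩) ?_, ?_⟩
      · convert hfq using 2
        push_cast
        ring
      · simp only [AlgHom.toLinearMap_apply, map_mul, map_pow, quotMap_apply]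
  · have := hB.finiteDim
    refine Module.Finite.of_surjective (∑ q : Fin d, LinearMap.mulLeft k (π X ^ (q : ℕ)) ∘ₗ
      (quotMap π).toLinearMap ∘ₗ LinearMap.proj (R := k) (φ := fun _ : Fin d => B) q) fun c => ?_
    obtain ⟨p, rfl⟩ := hπ c
    exact ⟨fun q => p.coeff q, by simpa using (quot_eq_sum hci.x_pow p).symm⟩

theorem exists_isCIExtension {k B : Type} [Field k] [CommRing B] [Algebra k B]
    {𝒜 : ℤ → Submodule k B} (hB : IsStdGradedArtinian k B 𝒜) (d : ℕ) :
    ∃ (A : Type) (_ : CommRing A) (_ : Algebra k A) (ℬ : ℤ → Submodule k A) (φ : B →ₐ[k] A)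
      (x : A), IsStdGradedArtinian k A ℬ ∧ IsCIExtension 𝒜 ℬ φ x d := by
  have hker : ∀ p, Ideal.Quotient.mkₐ k (Ideal.span {(X ^ d : B[X])}) p = 0 ↔ X ^ d ∣ p :=
      fun p => by
    rw [Ideal.Quotient.mkₐ_eq_mk, Ideal.Quotient.eq_zero_iff_mem, Ideal.mem_span_singleton]
  exact ⟨_, _, _, _, _, _, isStdGradedArtinian_quot hB (Ideal.Quotient.mkₐ_surjective k _) hker,
    isCIExtension_quot hB hker⟩

end Construction

section IteratedExtensions

variable {k B A A' : Type*} [Field k] [CommRing B] [Algebra k B] [CommRing A] [Algebra k A]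
  [CommRing A'] [Algebra k A'] {𝒜 : ℤ → Submodule k B} {ℬ : ℤ → Submodule k A}
  {ℬ' : ℤ → Submodule k A'} {φ : B →ₐ[k] A} {φ' : A →ₐ[k] A'} {d : ℕ}

theorem isMultiCIExtension_zero (𝒜 : ℤ → Submodule k B) (x : Fin 0 → B) (dv : Fin 0 → ℕ) :
    IsMultiCIExtension 𝒜 𝒜 (AlgHom.id k B) x dv where
  map_mem _ _ hb := hb
  x_mem m := m.elim0
  x_pow m := m.elim0
  decomp_mem j f hf := by simpa using hf default
  decomp_exists j c hc := ⟨fun _ => c, fun _ => by simpa using hc, by simp⟩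
  decomp_unique j f hf h0 e := by
    rw [Subsingleton.elim e default]
    simpa using h0

theorem IsMultiCIExtension.cons {n : ℕ} {x : Fin n → A} {y : A'}
    (hx : IsMultiCIExtension 𝒜 ℬ φ x (fun _ => d)) (hy : IsCIExtension ℬ ℬ' φ' y d) :
    IsMultiCIExtension 𝒜 ℬ' (φ'.comp φ) (Fin.cons y (φ' ∘ x) : Fin (n + 1) → A')
      (fun _ => d) := by
  have hsum : ∀ f : (Fin (n + 1) → Fin d) → B,
      ∑ e : Fin (n + 1) → Fin d, (∏ m, (Fin.cons y (φ' ∘ x) : Fin (n + 1) → A') m ^ (e m : ℕ)) *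
        φ'.comp φ (f e) = ∑ q : Fin d, y ^ (q : ℕ) * φ' (∑ e : Fin n → Fin d,
          (∏ m, x m ^ (e m : ℕ)) * φ (f (Fin.cons q e))) := fun f => by
    rw [sum_exponents_cons (dv := fun _ => d)]
    simp
  have hdeg : ∀ {j : ℤ} {f : (Fin (n + 1) → Fin d) → B},
      (∀ e, f e ∈ 𝒜 (j - ∑ m, ((e m : ℕ) : ℤ))) → ∀ (q : Fin d) (e : Fin n → Fin d),
      f (Fin.cons q e) ∈ 𝒜 (j - ((q : ℕ) : ℤ) - ∑ m, ((e m : ℕ) : ℤ)) := fun hf q e => by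
    rw [← sum_cons_exponents (dv := fun _ => d)]
    exact hf _
  refine ⟨fun j b hb => hy.map_mem j _ (hx.map_mem j b hb), ?_, ?_, fun j f hf => ?_,
    fun j c hc => ?_, fun j f hf h0 e => ?_⟩
  · refine Fin.cases hy.x_mem fun m => ?_
    exact hy.map_mem 1 _ (hx.x_mem m)
  · refine Fin.cases hy.x_pow fun m => ?_
    simp [← map_pow, hx.x_pow m]
  · rw [hsum]
    exact hy.decomp_mem j _ fun q => hx.decomp_mem _ _ (hdeg hf q)
  · obtain ⟨g, hg, rfl⟩ := hy.decomp_exists j c hc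
    choose F hF hgF using fun q => hx.decomp_exists _ (g q) (hg q)
    refine ⟨fun e => F (e 0) (Fin.tail e), fun e => ?_, ?_⟩
    · have := hF (e 0) (Fin.tail e)
      rw [← sum_cons_exponents (dv := fun _ => d), Fin.cons_self_tail] at this
      exact this
    · rw [hsum]
      exact Finset.sum_congr rfl fun q _ => by rw [hgF q]; simp
  · rw [hsum] at h0
    have h1 := hy.decomp_unique j _ (fun q => hx.decomp_mem _ _ (hdeg hf q)) h0 (e 0)
    have := hx.decomp_unique _ _ (hdeg hf (e 0)) h1 (Fin.tail e)
    rwa [Fin.cons_self_tail] at this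

end IteratedExtensions

section Obstructions

open Polynomial

variable {k B A : Type*} [Field k] [CommRing B] [Algebra k B] [CommRing A] [Algebra k A]
  {𝒜 : ℤ → Submodule k B} {ℬ : ℤ → Submodule k A} {φ : B →ₐ[k] A} {x : A} {d : ℕ}

/-- The coefficient of `x ^ (m - b)` in `(1 + c * x) ^ T`. -/
def powCoeff {k : Type*} [Field k] (T : ℕ) (c : k) (m b : ℕ) : k :=
  if b ≤ m then T.choose (m - b) * c ^ (m - b) else 0

theorem le_of_powCoeff_ne_zero {T : ℕ} {c : k} {m b : ℕ} (h : powCoeff T c m b ≠ 0) :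
    b ≤ m ∧ m - b ≤ T := by
  unfold powCoeff at h
  split_ifs at h with hb
  · refine ⟨hb, ?_⟩
    by_contra! hT
    exact h (by simp [Nat.choose_eq_zero_of_lt hT])
  · exact absurd rfl h

theorem coeff_linear_pow (ℓ : B) (c : k) (T r : ℕ) :
    ((c • X + C ℓ) ^ T : B[X]).coeff r = ((T.choose r : k) * c ^ r) • ℓ ^ (T - r) := by
  have h1 : ∀ j ∈ Finset.range (T + 1),
      ((c • X) ^ j * C ℓ ^ (T - j) * (T.choose j : B[X])).coeff r =
      if j = r then ((T.choose r : k) * c ^ r) • ℓ ^ (T - r) else 0 := by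
    intro j _
    have : (c • X : B[X]) ^ j * C ℓ ^ (T - j) * (T.choose j : B[X]) =
        C (((T.choose j : k) * c ^ j) • ℓ ^ (T - j)) * X ^ j := by
      rw [_root_.smul_pow, ← C_pow, mul_smul, ← smul_C, ← smul_C]
      simp only [Algebra.smul_def, map_natCast]
      ring
    rw [this, coeff_C_mul_X_pow]
    split_ifs with h1 h2 h2
    · rw [h1]
    · omega
    · omega
    · rfl
  rw [add_pow, finsetSum_coeff, Finset.sum_congr rfl h1, Finset.sum_ite_eq']
  split_ifs with h
  · rfl
  · rw [Nat.choose_eq_zero_of_lt (by simpa using h)]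
    simp

theorem coeff_linear_pow_mul (ℓ : B) (c : k) (T : ℕ) (p : B[X]) {m n : ℕ} (hmn : m < n) :
    ((c • X + C ℓ) ^ T * p).coeff m =
      ∑ b ∈ Finset.range n, powCoeff T c m b • (ℓ ^ (T - (m - b)) * p.coeff b) := by
  rw [mul_comm, coeff_mul, Finset.Nat.sum_antidiagonal_eq_sum_range_succ_mk]
  refine Finset.sum_subset_zero_on_sdiff (Finset.range_subset_range.mpr hmn) (fun b hb => ?_)
    fun b hb => ?_
  · rw [powCoeff, if_neg (by simp at hb; omega), zero_smul]
  · rw [powCoeff, if_pos (by simp at hb; omega), coeff_linear_pow, mul_comm, smul_mul_assoc]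

/-- The map `B[x] → A` given by a map on the coefficients and the image of the variable. -/
noncomputable def polyEval (φ : B →ₐ[k] A) (x : A) : B[X] →ₐ[k] A :=
  eval₂AlgHom φ x fun _ => Commute.all _ _

theorem polyEval_X (φ : B →ₐ[k] A) (x : A) : polyEval φ x X = x := by simp [polyEval]

theorem polyEval_C (φ : B →ₐ[k] A) (x : A) (b : B) : polyEval φ x (C b) = φ b := by
  simp [polyEval]

theorem polyEval_linear (φ : B →ₐ[k] A) (x : A) (ℓ : B) (c : k) :
    polyEval φ x (c • X + C ℓ) = φ ℓ + c • x := by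
  rw [map_add, map_smul, polyEval_X, polyEval_C, add_comm]

theorem IsCIExtension.polyEval_eq (hx : IsCIExtension 𝒜 ℬ φ x d) (p : B[X]) :
    polyEval φ x p = ∑ q : Fin d, x ^ (q : ℕ) * φ (p.coeff q) := by
  have := quot_eq_sum (π := polyEval φ x) (d := d) (by rw [polyEval_X, hx.x_pow]) p
  simpa only [polyEval_X, quotMap_apply, polyEval_C] using this

theorem IsCIExtension.polyEval_mem (hx : IsCIExtension 𝒜 ℬ φ x d) {j : ℤ} {p : B[X]}
    (hp : p ∈ homogPoly 𝒜 j) : polyEval φ x p ∈ ℬ j := by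
  rw [hx.polyEval_eq]
  exact hx.decomp_mem j _ fun q => hp q

theorem IsCIExtension.coeff_eq_zero (hx : IsCIExtension 𝒜 ℬ φ x d) {j : ℤ} {p : B[X]}
    (hp : p ∈ homogPoly 𝒜 j) (h0 : polyEval φ x p = 0) {q : ℕ} (hq : q < d) : p.coeff q = 0 := by
  rw [hx.polyEval_eq] at h0
  exact hx.decomp_unique j _ (fun q => hp q) h0 ⟨q, hq⟩

theorem IsCIExtension.exists_polyEval_eq (hx : IsCIExtension 𝒜 ℬ φ x d) {j : ℤ} {c : A}
    (hc : c ∈ ℬ j) : ∃ p ∈ homogPoly 𝒜 j, polyEval φ x p = c := by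
  obtain ⟨f, hf, rfl⟩ := hx.decomp_exists j c hc
  refine ⟨∑ q : Fin d, X ^ (q : ℕ) * C (f q),
    sum_mem fun q _ => X_pow_mul_C_mem_homogPoly (hf q), ?_⟩
  simp only [map_sum, map_mul, map_pow, polyEval_X, polyEval_C]

theorem linear_pow_mul_mem_homogPoly (hB : IsStdGradedArtinian k B 𝒜) {ℓ : B} (hℓ : ℓ ∈ 𝒜 1)
    (c : k) (T : ℕ) {j : ℤ} {p : B[X]} (hp : p ∈ homogPoly 𝒜 j) :
    (c • X + C ℓ) ^ T * p ∈ homogPoly 𝒜 (j + T) := by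
  intro m
  rw [coeff_linear_pow_mul ℓ c T p m.lt_succ_self]
  refine sum_mem fun b hb => ?_
  by_cases h : powCoeff T c m b = 0
  · rw [h, zero_smul]
    exact zero_mem _
  · obtain ⟨h1, h2⟩ := le_of_powCoeff_ne_zero h
    have := hB.pow_mul_mem hℓ (T - (m - b)) (hp b)
    rw [show j - (b : ℤ) + ((T - (m - b) : ℕ) : ℤ) = j + T - m by omega] at this
    exact Submodule.smul_mem _ _ this

theorem exists_ne_zero_of_linear_conditions {s : ℕ} (L : (ℕ → k) →ₗ[k] (Fin s → k)) :
    ∃ γ : ℕ → k, L γ = 0 ∧ (∀ b, s < b → γ b = 0) ∧ ∃ b ≤ s, γ b ≠ 0 := by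
  have hker := LinearMap.ker_ne_bot_of_finrank_lt
    (f := L ∘ₗ Function.ExtendByZero.linearMap k (Fin.val : Fin (s + 1) → ℕ)) (by simp)
  obtain ⟨γ, hγ, hne⟩ := Submodule.exists_mem_ne_zero_of_ne_bot hker
  refine ⟨_, hγ, fun b hb => ?_, ?_⟩
  · refine Function.extend_apply' _ _ _ ?_
    rintro ⟨a, rfl⟩
    omega
  · obtain ⟨b, hb⟩ := Function.ne_iff.mp hne
    refine ⟨b, by omega, ?_⟩
    rw [Function.ExtendByZero.linearMap_apply, Fin.val_injective.extend_apply]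
    exact hb

theorem IsCIExtension.not_mulInjOn (hB : IsStdGradedArtinian k B 𝒜)
    (hx : IsCIExtension 𝒜 ℬ φ x d) {ℓ : B} (hℓ : ℓ ∈ 𝒜 1) (c : k) {s t : ℕ} (hs : s < d)
    {i : ℤ} {v : B} (hv : v ∈ 𝒜 i) (hne : ℓ ^ s * v ≠ 0) (h0 : ℓ ^ (t + 2 * s) * v = 0) :
    ¬ MulInjOn (ℬ (i + s)) ((φ ℓ + c • x) ^ (t + d - 1)) := by
  intro hinj
  obtain ⟨γ, hL, hγ, b, hbs, hb⟩ := exists_ne_zero_of_linear_conditions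
    (LinearMap.pi fun r : Fin s => ∑ b ∈ Finset.range d,
      powCoeff (t + d - 1) c (d - s + r) b • LinearMap.proj (R := k) (φ := fun _ : ℕ => k) b)
  set p : B[X] := ∑ q : Fin d, X ^ (q : ℕ) * C (γ q • (ℓ ^ (s - q) * v)) with hp
  have hcoeff : ∀ q < d, p.coeff q = γ q • (ℓ ^ (s - q) * v) := fun q hq =>
    coeff_sum_X_pow_mul_C (fun q : Fin d => γ q • (ℓ ^ (s - (q : ℕ)) * v)) ⟨q, hq⟩
  have hpmem : p ∈ homogPoly 𝒜 (i + s) := sum_mem fun q _ => by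
    refine X_pow_mul_C_mem_homogPoly ?_
    rcases le_or_gt (q : ℕ) s with h | h
    · have := hB.pow_mul_mem hℓ (s - q) hv
      rw [show i + ((s - q : ℕ) : ℤ) = i + s - (q : ℕ) by omega] at this
      exact Submodule.smul_mem _ _ this
    · rw [hγ _ h, zero_smul]
      exact zero_mem _
  have hzero : polyEval φ x ((c • X + C ℓ) ^ (t + d - 1) * p) = 0 := by
    rw [hx.polyEval_eq]
    refine Finset.sum_eq_zero fun m _ => ?_
    have h1 : ((c • X + C ℓ) ^ (t + d - 1) * p).coeff m =
        (∑ b ∈ Finset.range d, powCoeff (t + d - 1) c m b * γ b) •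
          (ℓ ^ (t + d - 1 + s - m) * v) := by
      rw [coeff_linear_pow_mul ℓ c _ p m.2, Finset.sum_smul]
      refine Finset.sum_congr rfl fun b hb => ?_
      by_cases h : powCoeff (t + d - 1) c m b = 0
      · rw [h, zero_mul, zero_smul, zero_smul]
      rcases le_or_gt b s with hbs | hbs
      · obtain ⟨h1, h2⟩ := le_of_powCoeff_ne_zero h
        rw [hcoeff b (by simpa using hb), mul_smul_comm, ← mul_assoc, ← pow_add, smul_smul,
          show t + d - 1 - (m - b) + (s - b) = t + d - 1 + s - m by omega]
      · rw [hcoeff b (by simpa using hb), hγ b hbs, zero_smul, mul_zero, mul_zero, smul_zero,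
          zero_smul]
    have h2 : ((c • X + C ℓ) ^ (t + d - 1) * p).coeff m = 0 := by
      rw [h1]
      rcases lt_or_ge (m : ℕ) (d - s) with hm | hm
      · rw [show t + d - 1 + s - m = (d - 1 - s - m) + (t + 2 * s) by omega, pow_add, mul_assoc,
          h0, mul_zero, smul_zero]
      · have := congrFun hL ⟨m - (d - s), by omega⟩
        simp only [LinearMap.pi_apply, LinearMap.sum_apply, LinearMap.smul_apply,
          LinearMap.proj_apply, smul_eq_mul, Pi.zero_apply, Nat.add_sub_cancel' hm] at this
        rw [this, zero_smul]
    rw [h2, map_zero, mul_zero]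
  rw [map_mul, map_pow, polyEval_linear] at hzero
  have h3 := hx.coeff_eq_zero hpmem (hinj _ (hx.polyEval_mem hpmem) hzero)
    (q := b) (by omega)
  rw [hcoeff b (by omega), smul_eq_zero] at h3
  refine hne ?_
  rw [show s = b + (s - b) by omega, pow_add, mul_assoc, h3.resolve_left hb, mul_zero]

theorem IsCIExtension.not_mulSurjOnto (hB : IsStdGradedArtinian k B 𝒜)
    (hx : IsCIExtension 𝒜 ℬ φ x d) {ℓ : B} (hℓ : ℓ ∈ 𝒜 1) (c : k) {s t : ℕ} (hs : s < d) {i : ℤ}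
    (hS : ¬ MulSurjOnto (𝒜 i) (𝒜 (i + (t + 2 * s : ℕ))) (ℓ ^ (t + 2 * s)))
    (hsurj : MulSurjOnto (𝒜 (i + s + t)) (𝒜 (i + (t + 2 * s : ℕ))) (ℓ ^ s)) :
    ¬ MulSurjOnto (ℬ (i + s)) (ℬ (i + s + (t + d - 1 : ℕ))) ((φ ℓ + c • x) ^ (t + d - 1)) := by
  intro hsurj'
  simp only [MulSurjOnto, not_forall] at hS
  obtain ⟨a, ha, hna⟩ := hS
  obtain ⟨w, hwa, hw⟩ : ∃ w : B →ₗ[k] k, w a ≠ 0 ∧ ∀ u ∈ 𝒜 i, w (ℓ ^ (t + 2 * s) * u) = 0 := by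
    obtain ⟨w, hwa, hw⟩ := Submodule.exists_le_ker_of_notMem
      (p := (𝒜 i).map (LinearMap.mulLeft k (ℓ ^ (t + 2 * s)))) (v := a)
      (by rintro ⟨v, hv, h⟩; exact hna ⟨v, hv, h⟩)
    exact ⟨w, hwa, fun u hu => hw ⟨u, hu, rfl⟩⟩
  obtain ⟨y, hy, rfl⟩ := hsurj a ha
  obtain ⟨γ, hL, hγ, r, hrs, hr⟩ := exists_ne_zero_of_linear_conditions
    (LinearMap.pi fun b : Fin s => ∑ p ∈ Finset.range (s + 1),
      powCoeff (t + d - 1) c (d - 1 - p) b • LinearMap.proj (R := k) (φ := fun _ : ℕ => k) p)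
  have htmem : X ^ (d - 1 - r) * C (ℓ ^ r * y) ∈ homogPoly 𝒜 (i + s + (t + d - 1 : ℕ)) := by
    refine X_pow_mul_C_mem_homogPoly ?_
    have := hB.pow_mul_mem hℓ r hy
    convert this using 2
    omega
  obtain ⟨_, hc, hc'⟩ := hsurj' _ (hx.polyEval_mem htmem)
  obtain ⟨p, hp, rfl⟩ := hx.exists_polyEval_eq hc
  rw [← polyEval_linear, ← map_pow, ← map_mul, ← sub_eq_zero, ← map_sub] at hc'
  have hcoeff := fun m (hm : m < d) => hx.coeff_eq_zero
    (sub_mem (linear_pow_mul_mem_homogPoly hB hℓ c _ hp) htmem) hc' hm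
  simp only [coeff_sub, sub_eq_zero] at hcoeff
  have hval : ∀ p' ∈ Finset.range (s + 1), ∑ b ∈ Finset.range s,
      powCoeff (t + d - 1) c (d - 1 - p') b * w (ℓ ^ (t + s + b) * p.coeff b) =
        if p' = r then w (ℓ ^ s * y) else 0 := by
    intro p' hp'
    have hp's : p' ≤ s := by simpa [Nat.lt_succ_iff] using hp'
    have h1 := congrArg (fun u => w (ℓ ^ (s - p') * u)) (hcoeff (d - 1 - p') (by omega))
    simp only [coeff_linear_pow_mul ℓ c _ p (show d - 1 - p' < d by omega), Finset.mul_sum,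
      map_sum] at h1
    have h2 : ∀ b ∈ Finset.range d, w (ℓ ^ (s - p') * powCoeff (t + d - 1) c (d - 1 - p') b •
        (ℓ ^ (t + d - 1 - (d - 1 - p' - b)) * p.coeff b)) =
        powCoeff (t + d - 1) c (d - 1 - p') b * w (ℓ ^ (t + s + b) * p.coeff b) := by
      intro b _
      by_cases h : powCoeff (t + d - 1) c (d - 1 - p') b = 0
      · simp [h]
      · obtain ⟨h3, h4⟩ := le_of_powCoeff_ne_zero h
        rw [mul_smul_comm, map_smul, smul_eq_mul, ← mul_assoc, ← pow_add,
          show s - p' + (t + d - 1 - (d - 1 - p' - b)) = t + s + b by omega]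
    rw [Finset.sum_congr rfl h2] at h1
    rw [Finset.sum_subset (Finset.range_subset_range.mpr hs.le) fun b _ hb => ?_, h1, X_pow_mul,
      coeff_C_mul_X_pow]
    · by_cases h : p' = r
      · subst h
        rw [if_pos rfl, if_pos rfl, ← mul_assoc, ← pow_add, Nat.sub_add_cancel hp's]
      · rw [if_neg (by omega), if_neg h, mul_zero, map_zero]
    · have hb : s ≤ b := by simpa using hb
      have := hB.pow_mul_mem hℓ (b - s) (hp b)
      rw [show i + s - (b : ℤ) + ((b - s : ℕ) : ℤ) = i by omega] at this
      rw [show t + s + b = (t + 2 * s) + (b - s) by omega, pow_add, mul_assoc, hw _ this, mul_zero]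
  have hsum : ∑ p' ∈ Finset.range (s + 1), γ p' * (if p' = r then w (ℓ ^ s * y) else 0) = 0 := by
    rw [← Finset.sum_congr rfl fun p' hp' => congrArg (γ p' * ·) (hval p' hp')]
    simp_rw [Finset.mul_sum]
    rw [Finset.sum_comm]
    refine Finset.sum_eq_zero fun b hb => ?_
    have := congrFun hL ⟨b, by simpa using hb⟩
    simp only [LinearMap.pi_apply, LinearMap.sum_apply, LinearMap.smul_apply,
      LinearMap.proj_apply, smul_eq_mul, Pi.zero_apply] at this
    rw [← zero_mul (w (ℓ ^ (t + s + b) * p.coeff b)), ← this, Finset.sum_mul]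
    exact Finset.sum_congr rfl fun p' _ => by ring
  simp only [mul_ite, mul_zero, Finset.sum_ite_eq', Finset.mem_range] at hsum
  rw [if_pos (by omega), mul_eq_zero] at hsum
  exact hsum.elim hr hwa

end Obstructions

section Detection

open Polynomial

variable {k B A : Type*} [Field k] [CommRing B] [Algebra k B] [CommRing A] [Algebra k A]
  {𝒜 : ℤ → Submodule k B} {ℬ : ℤ → Submodule k A} {φ : B →ₐ[k] A} {x : A} {d : ℕ}

theorem IsCIExtension.exists_linear (hB : IsStdGradedArtinian k B 𝒜)
    (hx : IsCIExtension 𝒜 ℬ φ x d) {ℓ' : A} (hℓ' : ℓ' ∈ ℬ 1) :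
    ∃ ℓ ∈ 𝒜 1, ∃ c : k, ℓ' = φ ℓ + c • x := by
  obtain ⟨p, hp, rfl⟩ := hx.exists_polyEval_eq hℓ'
  have h0 : p.coeff 0 ∈ 𝒜 1 := by simpa using hp 0
  have h1 : p.coeff 1 ∈ 𝒜 0 := by simpa using hp 1
  rw [hB.zero_spanOne, Submodule.mem_span_singleton] at h1
  obtain ⟨c, hc⟩ := h1
  have hdeg : p.natDegree ≤ 1 := natDegree_le_iff_coeff_eq_zero.mpr fun q hq => by
    simpa [hB.neg_bot (1 - q) (by omega)] using hp q
  refine ⟨_, h0, c, ?_⟩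
  rw [← polyEval_linear]
  congr 1
  conv_lhs => rw [eq_X_add_C_of_natDegree_le_one hdeg, ← hc]
  rw [← smul_C, map_one, smul_mul_assoc, one_mul]

theorem IsCIExtension.not_mulInjOn_zero (hB : IsStdGradedArtinian k B 𝒜)
    (hx : IsCIExtension 𝒜 ℬ φ x d) (hd : 0 < d) {ℓ : B} (hℓ : ℓ ∈ 𝒜 1) (c : k) {t : ℕ} {i : ℤ}
    (h : ¬ MulInjOn (𝒜 i) (ℓ ^ t)) :
    ¬ MulInjOn (ℬ i) ((φ ℓ + c • x) ^ (t + d - 1)) := by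
  simp only [MulInjOn, not_forall] at h
  obtain ⟨v, hv, h0, hne⟩ := h
  simpa using hx.not_mulInjOn hB hℓ c hd hv (by simpa using hne) h0

theorem IsCIExtension.not_mulSurjOnto_zero (hB : IsStdGradedArtinian k B 𝒜)
    (hx : IsCIExtension 𝒜 ℬ φ x d) (hd : 0 < d) {ℓ : B} (hℓ : ℓ ∈ 𝒜 1) (c : k) {t : ℕ} {i : ℤ}
    (h : ¬ MulSurjOnto (𝒜 i) (𝒜 (i + t)) (ℓ ^ t)) :
    ¬ MulSurjOnto (ℬ i) (ℬ (i + (t + d - 1 : ℕ))) ((φ ℓ + c • x) ^ (t + d - 1)) := by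
  simpa using hx.not_mulSurjOnto hB hℓ c hd (i := i) (t := t) h
    (by simpa using mulSurjOnto_one _)

theorem IsCIExtension.isStrongLefschetz (hB : IsStdGradedArtinian k B 𝒜)
    (hx : IsCIExtension 𝒜 ℬ φ x d) (hd : 0 < d) {ℓ : B} (hℓ : ℓ ∈ 𝒜 1) {c : k}
    (h : IsStrongLefschetz ℬ (φ ℓ + c • x)) : IsStrongLefschetz 𝒜 ℓ := by
  intro i t
  by_contra hcon
  obtain ⟨h1, h2⟩ := not_or.mp hcon
  exact (h i (t + d - 1)).elim (hx.not_mulInjOn_zero hB hd hℓ c h1)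
    (hx.not_mulSurjOnto_zero hB hd hℓ c h2)

theorem IsCIExtension.isBalancedLefschetz (hB : IsStdGradedArtinian k B 𝒜) {D : ℕ}
    (htop : ∀ j : ℤ, (D : ℤ) < j → 𝒜 j = ⊥) (hx : IsCIExtension 𝒜 ℬ φ x d) (hd : D < d)
    {ℓ : B} (hℓ : ℓ ∈ 𝒜 1) {c : k} (h : IsStrongLefschetz ℬ (φ ℓ + c • x)) :
    IsBalancedLefschetz 𝒜 ℓ := by
  have hd0 : 0 < d := by omega
  have hS := hx.isStrongLefschetz hB hd0 hℓ h
  by_contra hP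
  obtain ⟨i, i', t, t', hit, hinj, hsurj⟩ := not_isBalancedLefschetz hP
  have hi : 0 ≤ i := by
    by_contra! hi
    exact hinj (hB.mulInjOn_of_neg hi _)
  have hi' : i' + t' ≤ D := by
    by_contra! hi'
    exact hsurj (mulSurjOnto_of_eq_bot (htop _ hi') _)
  obtain ⟨v, hv, h0, hne⟩ : ∃ v ∈ 𝒜 i, ℓ ^ t * v = 0 ∧ v ≠ 0 := by
    simpa only [MulInjOn, not_forall, exists_prop] using hinj
  rcases le_total i i' with hii | hii
  · obtain ⟨s, rfl⟩ := Int.le.dest hii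
    obtain rfl : t = t' + 2 * s := by omega
    have hne' : ℓ ^ s * v ≠ 0 := by
      intro hs
      rcases hS i (s + t') with h1 | h1
      · exact hne (h1 v hv (by rw [add_comm, pow_add, mul_assoc, hs, mul_zero]))
      · refine hsurj fun w hw => ?_
        obtain ⟨u, hu, rfl⟩ := h1 w (by rwa [Nat.cast_add, ← add_assoc])
        exact ⟨_, hB.pow_mul_mem hℓ s hu, by rw [← mul_assoc, ← pow_add, add_comm]⟩
    exact (h (i + s) (t' + d - 1)).elim
      (hx.not_mulInjOn hB hℓ c (by omega) hv hne' h0)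
      (hx.not_mulSurjOnto_zero hB hd0 hℓ c hsurj)
  · obtain ⟨s, rfl⟩ := Int.le.dest hii
    obtain rfl : t' = t + 2 * s := by omega
    refine (h (i' + s) (t + d - 1)).elim (hx.not_mulInjOn_zero hB hd0 hℓ c hinj)
      (hx.not_mulSurjOnto hB hℓ c (by omega) hsurj fun w hw => ?_)
    rcases hS (i' + s) (t + s) with h1 | h1
    · exact absurd (h1 v hv (by rw [add_comm, pow_add, mul_assoc, h0, mul_zero])) hne
    · obtain ⟨u, hu, rfl⟩ := h1 w (by
        rwa [show i' + (s : ℤ) + ((t + s : ℕ) : ℤ) = i' + ((t + 2 * s : ℕ) : ℤ) by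
          push_cast; ring])
      exact ⟨_, hB.pow_mul_mem hℓ t hu, by rw [← mul_assoc, ← pow_add, add_comm]⟩

theorem IsCIExtension.not_mulInjOn_flat (hB : IsStdGradedArtinian k B 𝒜)
    (hx : IsCIExtension 𝒜 ℬ φ x 2) {ℓ : B} (hℓ : ℓ ∈ 𝒜 1) (c : k) {u : ℕ} (hu : 1 ≤ u) {i : ℤ}
    (h : ¬ MulInjOn (𝒜 i) (ℓ ^ (u + 1))) : ¬ MulInjOn (ℬ (i + 1)) ((φ ℓ + c • x) ^ u) := by
  obtain ⟨t, rfl⟩ := Nat.exists_eq_add_of_le' hu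
  obtain ⟨v, hv, h0, hne⟩ : ∃ v ∈ 𝒜 i, ℓ ^ (t + 1 + 1) * v = 0 ∧ v ≠ 0 := by
    simpa only [MulInjOn, not_forall, exists_prop] using h
  by_cases hℓv : ℓ * v = 0
  · intro hinj
    have hmem : X ^ 1 * C v ∈ homogPoly 𝒜 (i + 1) :=
      X_pow_mul_C_mem_homogPoly (by simpa using hv)
    have hx2 : x * x = 0 := by rw [← pow_two, hx.x_pow]
    have hz : polyEval φ x (X ^ 1 * C v) = 0 := by
      refine hinj _ (hx.polyEval_mem hmem) ?_
      rw [pow_one, map_mul, polyEval_X, polyEval_C, pow_succ]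
      calc (φ ℓ + c • x) ^ t * (φ ℓ + c • x) * (x * φ v)
          = (φ ℓ + c • x) ^ t * (x * φ (ℓ * v) + c • ((x * x) * φ v)) := by
            simp only [map_mul, Algebra.smul_def]
            ring
        _ = 0 := by simp [hℓv, hx2]
    have := hx.coeff_eq_zero hmem hz (q := 1) (by omega)
    exact hne (by simpa using this)
  · exact hx.not_mulInjOn hB hℓ c (s := 1) (t := t) (by omega) hv (by simpa using hℓv) h0

theorem IsCIExtension.not_mulSurjOnto_flat (hB : IsStdGradedArtinian k B 𝒜)
    (hx : IsCIExtension 𝒜 ℬ φ x 2) {ℓ : B} (hℓ : ℓ ∈ 𝒜 1) (c : k) {u : ℕ} (hu : 1 ≤ u) {i : ℤ}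
    (h : ¬ MulSurjOnto (𝒜 i) (𝒜 (i + (u + 1 : ℕ))) (ℓ ^ (u + 1))) :
    ¬ MulSurjOnto (ℬ (i + 1)) (ℬ (i + 1 + u)) ((φ ℓ + c • x) ^ u) := by
  obtain ⟨t, rfl⟩ := Nat.exists_eq_add_of_le' hu
  by_cases hsurj : MulSurjOnto (𝒜 (i + 1 + t)) (𝒜 (i + (t + 1 + 1 : ℕ))) ℓ
  · exact hx.not_mulSurjOnto hB hℓ c (s := 1) (t := t) (by omega) h
      (by simpa only [Nat.cast_one, pow_one] using hsurj)
  · refine fun hs => hsurj fun a ha => ?_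
    have hamem : C a ∈ homogPoly 𝒜 (i + 1 + (t + 1 : ℕ)) := by
      have := X_pow_mul_C_mem_homogPoly (𝒜 := 𝒜) (j := i + 1 + (t + 1 : ℕ)) (q := 0) (b := a)
        (by convert ha using 2; push_cast; ring)
      simpa using this
    obtain ⟨w, hw, hwa⟩ := hs _ (hx.polyEval_mem hamem)
    obtain ⟨p, hp, rfl⟩ := hx.exists_polyEval_eq hw
    set L : B[X] := c • X + C ℓ with hL
    rw [← polyEval_linear, ← map_pow, ← map_mul, ← sub_eq_zero, ← map_sub] at hwa
    have h0 := hx.coeff_eq_zero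
      (sub_mem (linear_pow_mul_mem_homogPoly hB hℓ c (t + 1) hp) hamem) hwa (q := 0) (by omega)
    have hmem := linear_pow_mul_mem_homogPoly hB hℓ c t hp 0
    refine ⟨_, by simpa using hmem, ?_⟩
    rw [← hL, pow_succ', mul_assoc, coeff_sub, coeff_C_zero, mul_coeff_zero, sub_eq_zero] at h0
    simpa [hL] using h0

end Detection

section Pencils

variable {k R : Type*} [Field k] [CommRing R] [Algebra k R]

theorem finite_not_injective_one_add_smul {V : Type*} [AddCommGroup V] [Module k V]
    [FiniteDimensional k V] (h : Module.End k V) :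
    {s : k | ¬ Function.Injective (1 + s • h : Module.End k V)}.Finite := by
  have hfin : {μ : k | h.HasEigenvalue μ}.Finite := Module.End.finite_hasEigenvalue h
  refine (hfin.preimage (f := fun s : k => -s⁻¹)
    (neg_injective.comp inv_injective).injOn).subset fun s hs => ?_
  rw [Set.mem_ofPred_eq, injective_iff_map_eq_zero] at hs
  push Not at hs
  obtain ⟨v, hv, hne⟩ := hs
  replace hv : v + s • h v = 0 := hv
  have hs0 : s ≠ 0 := by
    rintro rfl
    exact hne (by simpa using hv)
  refine Module.End.hasEigenvalue_of_hasEigenvector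
    (x := v) ⟨Module.End.mem_eigenspace_iff.mpr ?_, hne⟩
  change h v = -s⁻¹ • v
  nth_rw 2 [eq_neg_of_add_eq_zero_left hv]
  rw [smul_neg, neg_smul, neg_neg, smul_smul, inv_mul_cancel₀ hs0, one_smul]

theorem MulFullRank.finite_pencil [FiniteDimensional k R] {V W : Submodule k R} {a b : R}
    (ha : ∀ v ∈ V, a * v ∈ W) (hb : ∀ v ∈ V, b * v ∈ W) (h : MulFullRank V W a) :
    {s : k | ¬ MulFullRank V W (a + s • b)}.Finite := by
  let f : V →ₗ[k] W := (LinearMap.mulLeft k a).restrict ha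
  let g : V →ₗ[k] W := (LinearMap.mulLeft k b).restrict hb
  have hfg : ∀ (s : k) (v : V), ((f v + s • g v : W) : R) = (a + s • b) * v := fun s v => by
    rw [add_mul, smul_mul_assoc]
    rfl
  rcases h with h | h
  · obtain ⟨p, hp⟩ := f.exists_leftInverse_of_injective (LinearMap.ker_eq_bot'.mpr fun v hv =>
      Subtype.ext (h v v.2 (congrArg Subtype.val hv)))
    refine (finite_not_injective_one_add_smul (p ∘ₗ g)).subset fun s hs hinj => hs (Or.inl ?_)
    intro v hv h0
    have h1 : f ⟨v, hv⟩ + s • g ⟨v, hv⟩ = 0 := Subtype.ext ((hfg s _).trans h0)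
    have h2 : (1 + s • (p ∘ₗ g)) ⟨v, hv⟩ = 0 := by
      have h3 := congrArg p h1
      rwa [map_add, map_smul, map_zero, ← LinearMap.comp_apply p f, hp] at h3
    exact congrArg Subtype.val (hinj (h2.trans (map_zero _).symm))
  · obtain ⟨q, hq⟩ := f.exists_rightInverse_of_surjective (LinearMap.range_eq_top.mpr fun w => by
      obtain ⟨v, hv, hvw⟩ := h w w.2
      exact ⟨⟨v, hv⟩, Subtype.ext hvw⟩)
    refine (finite_not_injective_one_add_smul (g ∘ₗ q)).subset fun s hs hinj => hs (Or.inr ?_)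
    intro w hw
    obtain ⟨u, hu⟩ := LinearMap.surjective_of_injective hinj ⟨w, hw⟩
    refine ⟨q u, (q u).2, ?_⟩
    have h1 : f (q u) + s • g (q u) = ⟨w, hw⟩ := by
      rwa [← LinearMap.comp_apply f q, hq]
    rw [← hfg, h1]

theorem IsStdGradedArtinian.finite_pencil {𝒜 : ℤ → Submodule k R}
    (hR : IsStdGradedArtinian k R 𝒜) {a b : R} (ha : a ∈ 𝒜 1) (hb : b ∈ 𝒜 1)
    (h : ∀ i : ℤ, 0 ≤ i → MulFullRank (𝒜 i) (𝒜 (i + 1)) a) :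
    {s : k | ¬ ∀ i : ℤ, 0 ≤ i → MulFullRank (𝒜 i) (𝒜 (i + 1)) (a + s • b)}.Finite := by
  have := hR.finiteDim
  have hmem : ∀ {a : R}, a ∈ 𝒜 1 → ∀ i, ∀ v ∈ 𝒜 i, a * v ∈ 𝒜 (i + 1) := fun ha i v hv => by
    rw [add_comm]
    exact hR.mul_mem ha hv
  have hfin : {i : ℤ | 𝒜 i ≠ ⊥}.Finite :=
    WellFoundedGT.finite_ne_bot_of_iSupIndep hR.internal.submodule_iSupIndep
  refine ((hfin.inter_of_left {i : ℤ | 0 ≤ i}).biUnion fun i hi =>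
    (h i hi.2).finite_pencil (hmem ha i) (hmem hb i)).subset fun s hs => ?_
  simp only [Set.mem_ofPred_eq, not_forall] at hs
  obtain ⟨i, hi, hs⟩ := hs
  refine Set.mem_biUnion (x := i) ⟨fun hbot => hs (Or.inl fun v hv _ => ?_), hi⟩ hs
  rwa [hbot, Submodule.mem_bot] at hv

end Pencils

section Squares

/-- Each failure `F i t` in a power `t ≥ 1` starting in degree `i` yields failures of `G` in
powers `u = t + n - 2 * r` starting in degree `i + r`, for `r ≤ n`. -/
def FailuresPersist (F G : ℤ → ℕ → Prop) (n : ℕ) : Prop :=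
  ∀ (i : ℤ) (t r u : ℕ), 1 ≤ t → 1 ≤ u → r ≤ n → u + 2 * r = t + n → F i t → G (i + r) u

theorem FailuresPersist.refl (F : ℤ → ℕ → Prop) : FailuresPersist F F 0 := by
  intro i t r u _ _ hr h hF
  obtain rfl : r = 0 := by omega
  obtain rfl : u = t := by omega
  simpa using hF

theorem FailuresPersist.succ {F G H : ℤ → ℕ → Prop} {n : ℕ} (h : FailuresPersist F G n)
    (h0 : ∀ i u, G i u → H i (u + 1)) (h1 : ∀ i u, 1 ≤ u → G i (u + 1) → H (i + 1) u) :
    FailuresPersist F H (n + 1) := by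
  intro i t r u ht hu hr hs hF
  rcases r with _ | r
  · obtain ⟨u, rfl⟩ := Nat.exists_eq_add_of_le' hu
    exact h0 _ _ (h i t 0 u ht (by omega) (by omega) (by omega) hF)
  · have := h1 _ _ hu (h i t r (u + 1) ht (by omega) (by omega) (by omega) hF)
    rwa [add_assoc, ← Nat.cast_succ] at this

variable {k B : Type} [Field k] [CommRing B] [Algebra k B] {𝒜 : ℤ → Submodule k B}

/-- A tower of quadratic extensions along which failures of injectivity and surjectivity persist,
for suitable splittings of the linear forms of the extension. -/
theorem exists_isMultiCIExtension_failuresPersist (hB : IsStdGradedArtinian k B 𝒜) (n : ℕ) :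
    ∃ (A : Type) (_ : CommRing A) (_ : Algebra k A) (ℬ : ℤ → Submodule k A) (φ : B →ₐ[k] A)
      (x : Fin n → A), IsStdGradedArtinian k A ℬ ∧ IsMultiCIExtension 𝒜 ℬ φ x (fun _ => 2) ∧
      ∀ ℓ' ∈ ℬ 1, ∃ ℓ ∈ 𝒜 1, ∃ z ∈ ℬ 1, ℓ' = φ ℓ + z ∧ ∀ y ∈ 𝒜 1,
        FailuresPersist (fun i t => ¬ MulInjOn (𝒜 i) (y ^ t))
          (fun i t => ¬ MulInjOn (ℬ i) ((φ y + z) ^ t)) n ∧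
        FailuresPersist (fun i t => ¬ MulSurjOnto (𝒜 i) (𝒜 (i + t)) (y ^ t))
          (fun i t => ¬ MulSurjOnto (ℬ i) (ℬ (i + t)) ((φ y + z) ^ t)) n := by
  induction n with
  | zero =>
    refine ⟨B, _, _, 𝒜, AlgHom.id k B, Fin.elim0, hB, isMultiCIExtension_zero 𝒜 _ _,
      fun ℓ hℓ => ⟨ℓ, hℓ, 0, zero_mem _, by simp, fun y _ => ?_⟩⟩
    simp only [AlgHom.coe_id, id_eq, add_zero]
    exact ⟨.refl _, .refl _⟩
  | succ n ih =>
    obtain ⟨A, _, _, ℬ, φ, x, hA, hx, hsplit⟩ := ih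
    obtain ⟨A', _, _, ℬ', φ', x', hA', hx'⟩ := exists_isCIExtension hA 2
    refine ⟨A', _, _, ℬ', φ'.comp φ, _, hA', hx.cons hx', fun ℓ'' hℓ'' => ?_⟩
    obtain ⟨ℓ', hℓ', c, rfl⟩ := hx'.exists_linear hA hℓ''
    obtain ⟨ℓ, hℓ, z, hz, rfl, hpersist⟩ := hsplit ℓ' hℓ'
    refine ⟨ℓ, hℓ, φ' z + c • x', add_mem (hx'.map_mem _ _ hz) (Submodule.smul_mem _ _ hx'.x_mem),
      by simp [add_assoc], fun y hy => ?_⟩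
    obtain ⟨hinj, hsurj⟩ := hpersist y hy
    have hy' := add_mem (hx.map_mem _ _ hy) hz
    rw [AlgHom.comp_apply, ← add_assoc, ← map_add]
    exact ⟨hinj.succ (fun i u h => hx'.not_mulInjOn_zero hA two_pos hy' c h)
        fun i u hu h => hx'.not_mulInjOn_flat hA hy' c hu h,
      hsurj.succ (fun i u h => hx'.not_mulSurjOnto_zero hA two_pos hy' c h)
        fun i u hu h => hx'.not_mulSurjOnto_flat hA hy' c hu h⟩

theorem exists_isBalancedLefschetz_of_hasWLP [CharZero k] (hB : IsStdGradedArtinian k B 𝒜) {D : ℕ}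
    (htop : ∀ j : ℤ, (D : ℤ) < j → 𝒜 j = ⊥)
    (h : ∀ (n : ℕ), 1 ≤ n → ∀ (A : Type) [CommRing A] [Algebra k A]
      (ℬ : ℤ → Submodule k A) (φ : B →ₐ[k] A) (x : Fin n → A),
      IsStdGradedArtinian k A ℬ → IsMultiCIExtension 𝒜 ℬ φ x (fun _ => 2) → HasWLP ℬ) :
    ∃ ℓ ∈ 𝒜 1, IsBalancedLefschetz 𝒜 ℓ := by
  have key : ∀ n : ℕ, 2 * D + 1 ≤ n → ∃ ℓ ∈ 𝒜 1, ∀ b ∈ 𝒜 1,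
      {s : k | ∃ (i i' : ℤ) (t t' : ℕ), 2 * i + t = 2 * i' + t' ∧ Odd (t + n) ∧
        ¬ MulInjOn (𝒜 i) ((ℓ + s • b) ^ t) ∧
        ¬ MulSurjOnto (𝒜 i') (𝒜 (i' + t')) ((ℓ + s • b) ^ t')}.Finite := by
    intro n hn
    obtain ⟨A, _, _, ℬ, φ, x, hA, hx, hsplit⟩ := exists_isMultiCIExtension_failuresPersist hB n
    obtain ⟨ℓ', hℓ', hwlp⟩ := h n (by omega) A ℬ φ x hA hx
    obtain ⟨ℓ, hℓ, z, hz, rfl, hpersist⟩ := hsplit ℓ' hℓ'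
    refine ⟨ℓ, hℓ, fun b hb => (hA.finite_pencil hℓ' (hx.map_mem _ _ hb) hwlp).subset ?_⟩
    rintro s ⟨i, i', t, t', hit, ⟨m, hm⟩, hinj, hsurj⟩ hfull
    have hi : 0 ≤ i := by
      by_contra! hi
      exact hinj (hB.mulInjOn_of_neg hi _)
    have hi' : i' + t' ≤ D := by
      by_contra! hi'
      exact hsurj (mulSurjOnto_of_eq_bot (htop _ hi') _)
    have ht : 1 ≤ t := by
      by_contra! ht
      obtain rfl : t = 0 := by omega
      exact hinj (by simpa using mulInjOn_one _)
    have ht' : 1 ≤ t' := by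
      by_contra! ht'
      obtain rfl : t' = 0 := by omega
      exact hsurj (by simpa using mulSurjOnto_one _)
    obtain ⟨m', hm'⟩ : ∃ m' : ℕ, t' + n = 2 * m' + 1 := ⟨(t' + n) / 2, by omega⟩
    obtain ⟨h1, h2⟩ := hpersist (ℓ + s • b) (add_mem hℓ (Submodule.smul_mem _ _ hb))
    replace h1 := h1 i t m 1 ht le_rfl (by omega) (by omega) hinj
    replace h2 := h2 i' t' m' 1 ht' le_rfl (by omega) (by omega) hsurj
    rw [show φ (ℓ + s • b) + z = φ ℓ + z + s • φ b by rw [map_add, map_smul]; ring,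
      pow_one] at h1 h2
    rw [show i' + (m' : ℤ) = i + m by omega, Nat.cast_one] at h2
    exact (hfull (i + m) (by omega)).elim h1 h2
  obtain ⟨ℓ₁, hℓ₁, h₁⟩ := key (2 * D + 1) le_rfl
  obtain ⟨ℓ₂, hℓ₂, h₂⟩ := key (2 * D + 1 + 1) (Nat.le_succ _)
  have hb := sub_mem hℓ₂ hℓ₁
  obtain ⟨s, hs⟩ := ((h₁ _ hb).union ((h₂ _ hb).preimage
    (sub_left_injective (b := (1 : k))).injOn)).exists_notMem
  refine ⟨ℓ₁ + s • (ℓ₂ - ℓ₁), add_mem hℓ₁ (Submodule.smul_mem _ _ hb), ?_⟩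
  by_contra hP
  obtain ⟨i, i', t, t', hit, hinj, hsurj⟩ := not_isBalancedLefschetz hP
  refine hs ?_
  rcases Nat.even_or_odd (t + (2 * D + 1)) with h | h
  · refine Or.inr ⟨i, i', t, t', hit, h.add_one, ?_⟩
    rw [show ℓ₂ + (s - 1) • (ℓ₂ - ℓ₁) = ℓ₁ + s • (ℓ₂ - ℓ₁) by rw [sub_smul, one_smul]; ring]
    exact ⟨hinj, hsurj⟩
  · exact Or.inl ⟨i, i', t, t', hit, h, hinj, hsurj⟩

theorem exists_isBalancedLefschetz_of_hasSLP (hB : IsStdGradedArtinian k B 𝒜) {D : ℕ}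
    (htop : ∀ j : ℤ, (D : ℤ) < j → 𝒜 j = ⊥)
    (h : ∀ (A : Type) [CommRing A] [Algebra k A] (ℬ : ℤ → Submodule k A) (φ : B →ₐ[k] A) (x : A),
      IsStdGradedArtinian k A ℬ → IsCIExtension 𝒜 ℬ φ x (D + 1) → HasSLP ℬ) :
    ∃ ℓ ∈ 𝒜 1, IsBalancedLefschetz 𝒜 ℓ := by
  obtain ⟨A, _, _, ℬ, φ, x, hA, hx⟩ := exists_isCIExtension hB (D + 1)
  obtain ⟨ℓ', hℓ', hS⟩ := (h A ℬ φ x hA hx).exists_isStrongLefschetz hA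
  obtain ⟨ℓ, hℓ, c, rfl⟩ := hx.exists_linear hB hℓ'
  exact ⟨ℓ, hℓ, hx.isBalancedLefschetz hB htop D.lt_succ_self hℓ hS⟩

end Squares

/-- Over a field `k` of characteristic zero, for a standard graded
artinian `k`-algebra `A` of socle degree `D` the following are equivalent:
(1) `A` is almost centered and has the SLP;
(2) `A` has the SLP and its Hilbert function satisfies one of the two chains of
inequalities `h_{i-1} ≤ h_{D-i} ≤ h_i` or `h_{D-i+1} ≤ h_i ≤ h_{D-i}` for all
`0 ≤ i ≤ ⌊D/2⌋`;
(3) `A ⊗ₖ k[x]/(x^d)` has the SLP for all `d ≥ 1`;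
(4) `A ⊗ₖ k[x₁,…,xₙ]/(x₁^{d₁},…,xₙ^{dₙ})` has the SLP for all `n ≥ 1`, `d₁,…,dₙ ≥ 1`;
(5) `A ⊗ₖ k[x₁,…,xₙ]/(x₁²,…,xₙ²)` has the WLP for all `n ≥ 0`. -/
theorem statement_19 {k B : Type} [Field k] [CharZero k]
    [CommRing B] [Algebra k B]
    (𝒜 : ℤ → Submodule k B) (hB : IsStdGradedArtinian k B 𝒜)
    (D : ℕ) (hsocle : 𝒜 (D : ℤ) ≠ ⊥) (htop : ∀ j : ℤ, (D : ℤ) < j → 𝒜 j = ⊥) :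
    ((AlmostCentered 𝒜 ∧ HasSLP 𝒜) ↔
      (HasSLP 𝒜 ∧
        ((∀ i : ℕ, i ≤ D / 2 →
            hilb 𝒜 ((i : ℤ) - 1) ≤ hilb 𝒜 ((D : ℤ) - i) ∧
            hilb 𝒜 ((D : ℤ) - i) ≤ hilb 𝒜 (i : ℤ)) ∨
         (∀ i : ℕ, i ≤ D / 2 →
            hilb 𝒜 ((D : ℤ) - i + 1) ≤ hilb 𝒜 (i : ℤ) ∧
            hilb 𝒜 (i : ℤ) ≤ hilb 𝒜 ((D : ℤ) - i))))) ∧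
    ((AlmostCentered 𝒜 ∧ HasSLP 𝒜) ↔
      (∀ (d : ℕ), 1 ≤ d →
        ∀ (A : Type) [CommRing A] [Algebra k A],
          ∀ (ℬ : ℤ → Submodule k A) (φ : B →ₐ[k] A) (x : A),
            IsStdGradedArtinian k A ℬ → IsCIExtension 𝒜 ℬ φ x d → HasSLP ℬ)) ∧
    ((AlmostCentered 𝒜 ∧ HasSLP 𝒜) ↔
      (∀ (n : ℕ), 1 ≤ n → ∀ (dv : Fin n → ℕ), (∀ j, 1 ≤ dv j) →
        ∀ (A : Type) [CommRing A] [Algebra k A],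
          ∀ (ℬ : ℤ → Submodule k A) (φ : B →ₐ[k] A) (x : Fin n → A),
            IsStdGradedArtinian k A ℬ → IsMultiCIExtension 𝒜 ℬ φ x dv → HasSLP ℬ)) ∧
    ((AlmostCentered 𝒜 ∧ HasSLP 𝒜) ↔
      (∀ (n : ℕ),
        ∀ (A : Type) [CommRing A] [Algebra k A],
          ∀ (ℬ : ℤ → Submodule k A) (φ : B →ₐ[k] A) (x : Fin n → A),
            IsStdGradedArtinian k A ℬ →
            IsMultiCIExtension 𝒜 ℬ φ x (fun _ => 2) → HasWLP ℬ)) := by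
  have hP := almostCentered_and_hasSLP_iff hB
  refine ⟨⟨fun h => ?_, fun ⟨hS, hc⟩ => ?_⟩, ⟨fun h d hd A _ _ ℬ φ x _ hx => ?_, fun h => ?_⟩,
    ⟨fun h n _ dv hdv A _ _ ℬ φ x _ hx => ?_, fun h => ?_⟩,
    ⟨fun h n A _ _ ℬ φ x _ hx => ?_, fun h => ?_⟩⟩
  · obtain ⟨ℓ, hℓ, hb⟩ := hP.mp h
    exact ⟨h.2, hb.hilb_chain hB hℓ hsocle htop⟩
  · obtain ⟨ℓ, hℓ, hs⟩ := hS.exists_isStrongLefschetz hB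
    exact hP.mpr ⟨ℓ, hℓ, hs.isBalancedLefschetz_of_hilb_chain hB hℓ htop hc⟩
  · obtain ⟨ℓ, hℓ, hb⟩ := hP.mp h
    exact hb.extend hB hℓ hd hx
  · exact hP.mpr (exists_isBalancedLefschetz_of_hasSLP hB htop (h (D + 1) (Nat.le_add_left 1 D)))
  · obtain ⟨ℓ, hℓ, hb⟩ := hP.mp h
    exact hb.extend_multi hB hℓ hdv hx
  · refine hP.mpr (exists_isBalancedLefschetz_of_hasWLP hB htop fun n hn A _ _ ℬ φ x hA hx => ?_)
    exact (h n hn _ (fun _ => one_le_two) A ℬ φ x hA hx).hasWLP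
  · obtain ⟨ℓ, hℓ, hb⟩ := hP.mp h
    exact (hb.extend_multi hB hℓ (fun _ => one_le_two) hx).hasWLP
  · exact hP.mpr (exists_isBalancedLefschetz_of_hasWLP hB htop fun n _ => h n)
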